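/- Let (f,g,ρ) be a warped Berger solution of Ricci flow on S^1×S^3 defined on [0,T) satisfying Assumption B. Then the radius of a smallest neck is (1+o(1))·2√(T−t) as t ↗ T; that is, lim_{t↗T} M̌(t)/√(T−t) = 2. -/

import Mathlib

open Real Set Filter Topology

noncomputable section

/-- Partial derivative in the first (spatial, `ξ`) variable. -/
def pd1 (φ : ℝ → ℝ → ℝ) (ξ t : ℝ) : ℝ := deriv (fun x => φ x t) ξ

/-- Partial derivative in the second (time) variable: `φ_t`. -/
def pdt (φ : ℝ → ℝ → ℝ) (ξ t : ℝ) : ℝ := deriv (fun τ => φ ξ τ) t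

/-- Derivative with respect to arclength `s` (where `ds = ρ dξ`): `φ_s := ρ⁻¹ ∂_ξ φ`. -/
def Ds (ρ φ : ℝ → ℝ → ℝ) (ξ t : ℝ) : ℝ := pd1 φ ξ t / ρ ξ t

/-- Sectional curvature `κ₁₂ = κ₃₁ = f²/g⁴ − f_s g_s/(f g)`. -/
def k12 (ρ f g : ℝ → ℝ → ℝ) (ξ t : ℝ) : ℝ :=
  (f ξ t) ^ 2 / (g ξ t) ^ 4 - Ds ρ f ξ t * Ds ρ g ξ t / (f ξ t * g ξ t)

/-- Sectional curvature `κ₃₁ = κ₁₂`. -/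
def k31 (ρ f g : ℝ → ℝ → ℝ) (ξ t : ℝ) : ℝ :=
  (f ξ t) ^ 2 / (g ξ t) ^ 4 - Ds ρ f ξ t * Ds ρ g ξ t / (f ξ t * g ξ t)

/-- Sectional curvature `κ₂₃ = (4g² − 3f²)/g⁴ − g_s²/g²`. -/
def k23 (ρ f g : ℝ → ℝ → ℝ) (ξ t : ℝ) : ℝ :=
  (4 * (g ξ t) ^ 2 - 3 * (f ξ t) ^ 2) / (g ξ t) ^ 4 - (Ds ρ g ξ t) ^ 2 / (g ξ t) ^ 2

/-- Sectional curvature `κ₀₁ = −f_ss/f`. -/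
def k01 (ρ f : ℝ → ℝ → ℝ) (ξ t : ℝ) : ℝ := -(Ds ρ (Ds ρ f) ξ t) / f ξ t

/-- Sectional curvature `κ₀₂ = κ₀₃ = −g_ss/g`. -/
def k02 (ρ g : ℝ → ℝ → ℝ) (ξ t : ℝ) : ℝ := -(Ds ρ (Ds ρ g) ξ t) / g ξ t

/-- Scalar curvature `R = κ₀₁ + 2κ₀₂ + 2κ₁₂ + κ₂₃`. -/
def scalR (ρ f g : ℝ → ℝ → ℝ) (ξ t : ℝ) : ℝ :=
  k01 ρ f ξ t + 2 * k02 ρ g ξ t + 2 * k12 ρ f g ξ t + k23 ρ f g ξ t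

/-- `M(ξ,t) := min {f(ξ,t), g(ξ,t)}`. -/
def M (f g : ℝ → ℝ → ℝ) (ξ t : ℝ) : ℝ := min (f ξ t) (g ξ t)

/-- `M̌(t) := min_{ξ ∈ S¹} M(ξ,t)`. -/
def Mcheck (f g : ℝ → ℝ → ℝ) (t : ℝ) : ℝ := ⨅ ξ : ℝ, M f g ξ t

/-- A warped Berger solution of Ricci flow on `S¹ × S³` with (finite) existence time `T`:
smooth positive `2π`-periodic-in-`ξ` functions `f, g, ρ` on `S¹ × [0,T)` satisfying
  `f_t = f_ss + 2 (g_s/g) f_s − 2 f³/g⁴`,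
  `g_t = g_ss + (f_s/f + g_s/g) g_s + 2 (f² − 2g²)/g³`,
  `(log ρ)_t = f_ss/f + 2 g_ss/g`. -/
structure WarpedBerger (T : ℝ) (f g ρ : ℝ → ℝ → ℝ) : Prop where
  T_pos : 0 < T
  f_pos : ∀ ξ t : ℝ, 0 ≤ t → t < T → 0 < f ξ t
  g_pos : ∀ ξ t : ℝ, 0 ≤ t → t < T → 0 < g ξ t
  ρ_pos : ∀ ξ t : ℝ, 0 ≤ t → t < T → 0 < ρ ξ t
  f_per : ∀ ξ t : ℝ, f (ξ + 2 * π) t = f ξ t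
  g_per : ∀ ξ t : ℝ, g (ξ + 2 * π) t = g ξ t
  ρ_per : ∀ ξ t : ℝ, ρ (ξ + 2 * π) t = ρ ξ t
  smooth : ContDiffOn ℝ (⊤ : ℕ∞)
      (fun p : ℝ × ℝ => (f p.1 p.2, g p.1 p.2, ρ p.1 p.2)) (Set.univ ×ˢ Set.Ico 0 T)
  eq_f : ∀ ξ t : ℝ, 0 < t → t < T →
    pdt f ξ t = Ds ρ (Ds ρ f) ξ t + 2 * (Ds ρ g ξ t / g ξ t) * Ds ρ f ξ t
      - 2 * (f ξ t) ^ 3 / (g ξ t) ^ 4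
  eq_g : ∀ ξ t : ℝ, 0 < t → t < T →
    pdt g ξ t = Ds ρ (Ds ρ g) ξ t
      + (Ds ρ f ξ t / f ξ t + Ds ρ g ξ t / g ξ t) * Ds ρ g ξ t
      + 2 * ((f ξ t) ^ 2 - 2 * (g ξ t) ^ 2) / (g ξ t) ^ 3
  eq_ρ : ∀ ξ t : ℝ, 0 < t → t < T →
    pdt (fun x τ => Real.log (ρ x τ)) ξ t
      = Ds ρ (Ds ρ f) ξ t / f ξ t + 2 * (Ds ρ (Ds ρ g) ξ t / g ξ t)

/-- The Ricci curvature blows up as `t ↗ T`: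
`limsup_{t↗T} max_ξ (|κ₀₁+2κ₁₂| + |κ₀₁+2κ₀₂| + |κ₀₂+κ₁₂+κ₂₃|) = ∞`, where the three
displayed quantities are the diagonal components of the Ricci tensor. -/
def RicciBlowup (T : ℝ) (f g ρ : ℝ → ℝ → ℝ) : Prop :=
  ∀ K : ℝ, ∀ t₀ : ℝ, 0 ≤ t₀ → t₀ < T → ∃ ξ t : ℝ, t₀ < t ∧ t < T ∧
    K < |k01 ρ f ξ t + 2 * k12 ρ f g ξ t| + |k01 ρ f ξ t + 2 * k02 ρ g ξ t|
        + |k02 ρ g ξ t + k12 ρ f g ξ t + k23 ρ f g ξ t|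

/-- Assumption A: `f ≤ g` at `t = 0`; `(min_ξ R(ξ,0))·(max_ξ g(ξ,0)²) > −3`;
and the Ricci curvature blows up at the finite time `T`. -/
structure AssumptionA (T : ℝ) (f g ρ : ℝ → ℝ → ℝ) extends WarpedBerger T f g ρ : Prop where
  init_order : ∀ ξ : ℝ, f ξ 0 ≤ g ξ 0
  init_scalar : (⨅ ξ : ℝ, scalR ρ f g ξ 0) * (⨆ ξ : ℝ, (g ξ 0) ^ 2) > -3
  ricci_blowup : RicciBlowup T f g ρ

/-- Assumption B: Assumption A and, in addition, at `t = 0` one has `f ≥ (1−ε)g` for some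
`ε ∈ (0,1)` with `2(1−ε)⁵ + 4(1−ε)⁴ > 4/3`, and `|f_s| ≤ 1` at `t = 0`. -/
structure AssumptionB (T : ℝ) (f g ρ : ℝ → ℝ → ℝ) extends AssumptionA T f g ρ : Prop where
  init_pinched : ∃ ε : ℝ, 0 < ε ∧ ε < 1 ∧ 2 * (1 - ε) ^ 5 + 4 * (1 - ε) ^ 4 > 4 / 3 ∧
    ∀ ξ : ℝ, (1 - ε) * g ξ 0 ≤ f ξ 0
  init_fs : ∀ ξ : ℝ, |Ds ρ f ξ 0| ≤ 1

section
set_option linter.unusedVariables false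

def Sm (T : ℝ) (φ : ℝ → ℝ → ℝ) : Prop :=
  ContDiffOn ℝ (⊤ : ℕ∞) (fun p : ℝ × ℝ => φ p.1 p.2) (Set.univ ×ˢ Set.Ioo 0 T)

def Per (φ : ℝ → ℝ → ℝ) : Prop := ∀ ξ t : ℝ, φ (ξ + 2 * π) t = φ ξ t

lemma isOpen_Om (T : ℝ) : IsOpen ((Set.univ : Set ℝ) ×ˢ Set.Ioo (0:ℝ) T) :=
  isOpen_univ.prod isOpen_Ioo

lemma two_le_top' : (2 : WithTop ℕ∞) ≤ ((⊤:ℕ∞) : WithTop ℕ∞) := by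
  have : ((2:ℕ∞):WithTop ℕ∞) ≤ ((⊤:ℕ∞):WithTop ℕ∞) := WithTop.coe_le_coe.2 le_top
  exact this

namespace Sm
variable {T : ℝ} {φ ψ ρ : ℝ → ℝ → ℝ}

lemma at' (h : Sm T φ) {ξ t : ℝ} (ht : 0 < t ∧ t < T) :
    ContDiffAt ℝ (⊤ : ℕ∞) (fun p : ℝ × ℝ => φ p.1 p.2) (ξ, t) :=
  ContDiffOn.contDiffAt h ((isOpen_Om T).mem_nhds ⟨mem_univ _, ht⟩)

lemma diff (h : Sm T φ) {ξ t : ℝ} (ht : 0 < t ∧ t < T) :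
    DifferentiableAt ℝ (fun p : ℝ × ℝ => φ p.1 p.2) (ξ, t) :=
  (h.at' ht).differentiableAt (by simp)

lemma hx0 (h : Sm T φ) {ξ t : ℝ} (ht : 0 < t ∧ t < T) :
    HasDerivAt (fun y => φ y t) (fderiv ℝ (fun p : ℝ × ℝ => φ p.1 p.2) (ξ, t) (1, 0)) ξ := by
  have h1 := (h.diff (ξ := ξ) ht).hasFDerivAt
  have h2 : HasDerivAt (fun y : ℝ => (y, t)) ((1:ℝ), (0:ℝ)) ξ :=
    (hasDerivAt_id ξ).prodMk (hasDerivAt_const ξ t)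
  exact h1.comp_hasDerivAt ξ h2

lemma ht0 (h : Sm T φ) {ξ t : ℝ} (ht : 0 < t ∧ t < T) :
    HasDerivAt (fun τ => φ ξ τ) (fderiv ℝ (fun p : ℝ × ℝ => φ p.1 p.2) (ξ, t) (0, 1)) t := by
  have h1 := (h.diff (ξ := ξ) ht).hasFDerivAt
  have h2 : HasDerivAt (fun y : ℝ => (ξ, y)) ((0:ℝ), (1:ℝ)) t :=
    (hasDerivAt_const t ξ).prodMk (hasDerivAt_id t)
  exact h1.comp_hasDerivAt t h2

lemma pd1_eq (h : Sm T φ) {ξ t : ℝ} (ht : 0 < t ∧ t < T) :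
    pd1 φ ξ t = fderiv ℝ (fun p : ℝ × ℝ => φ p.1 p.2) (ξ, t) (1, 0) := (h.hx0 ht).deriv

lemma pdt_eq (h : Sm T φ) {ξ t : ℝ} (ht : 0 < t ∧ t < T) :
    pdt φ ξ t = fderiv ℝ (fun p : ℝ × ℝ => φ p.1 p.2) (ξ, t) (0, 1) := (h.ht0 ht).deriv

lemma hx (h : Sm T φ) {ξ t : ℝ} (ht : 0 < t ∧ t < T) :
    HasDerivAt (fun y => φ y t) (pd1 φ ξ t) ξ := by
  rw [h.pd1_eq ht]; exact h.hx0 ht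

lemma htt (h : Sm T φ) {ξ t : ℝ} (ht : 0 < t ∧ t < T) :
    HasDerivAt (fun τ => φ ξ τ) (pdt φ ξ t) t := by
  rw [h.pdt_eq ht]; exact h.ht0 ht

lemma fd (h : Sm T φ) (w : ℝ × ℝ) : ContDiffOn ℝ (⊤ : ℕ∞)
    (fun p => fderiv ℝ (fun p : ℝ × ℝ => φ p.1 p.2) p w) (Set.univ ×ˢ Set.Ioo 0 T) := by
  have := ContDiffOn.fderiv_of_isOpen (m := ((⊤:ℕ∞) : WithTop ℕ∞)) h (isOpen_Om T) (by simp)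
  exact this.clm_apply contDiffOn_const

lemma pd1 (h : Sm T φ) : Sm T (pd1 φ) :=
  (h.fd (1,0)).congr (fun p hp => h.pd1_eq hp.2)

lemma pdt (h : Sm T φ) : Sm T (pdt φ) :=
  (h.fd (0,1)).congr (fun p hp => h.pdt_eq hp.2)

lemma add (h : Sm T φ) (h' : Sm T ψ) : Sm T (fun ξ t => φ ξ t + ψ ξ t) := ContDiffOn.add h h'
lemma sub (h : Sm T φ) (h' : Sm T ψ) : Sm T (fun ξ t => φ ξ t - ψ ξ t) := ContDiffOn.sub h h'
lemma mul (h : Sm T φ) (h' : Sm T ψ) : Sm T (fun ξ t => φ ξ t * ψ ξ t) := ContDiffOn.mul h h'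
lemma pow (h : Sm T φ) (n : ℕ) : Sm T (fun ξ t => φ ξ t ^ n) := ContDiffOn.pow h n
lemma neg (h : Sm T φ) : Sm T (fun ξ t => - φ ξ t) := ContDiffOn.neg h
lemma const (c : ℝ) : Sm T (fun _ _ => c) := contDiffOn_const
lemma time : Sm T (fun _ t => t) := contDiffOn_snd
lemma exp (h : Sm T φ) : Sm T (fun ξ t => Real.exp (φ ξ t)) := ContDiffOn.exp h
lemma log (h : Sm T φ) (hp : ∀ ξ t, 0 < t → t < T → 0 < φ ξ t) :
    Sm T (fun ξ t => Real.log (φ ξ t)) :=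
  ContDiffOn.log h (fun p hp' => (hp _ _ hp'.2.1 hp'.2.2).ne')
lemma div (h : Sm T φ) (h' : Sm T ψ) (hp : ∀ ξ t, 0 < t → t < T → 0 < ψ ξ t) :
    Sm T (fun ξ t => φ ξ t / ψ ξ t) :=
  ContDiffOn.div h h' (fun p hp' => (hp _ _ hp'.2.1 hp'.2.2).ne')

lemma Ds (h : Sm T φ) (hρ : Sm T ρ) (hp : ∀ ξ t, 0 < t → t < T → 0 < ρ ξ t) : Sm T (Ds ρ φ) :=
  h.pd1.div hρ hp

lemma cont (h : Sm T φ) : ContinuousOn (fun p : ℝ × ℝ => φ p.1 p.2) (Set.univ ×ˢ Set.Ioo 0 T) :=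
  ContDiffOn.continuousOn h

lemma comm (h : Sm T φ) {ξ t : ℝ} (ht : 0 < t ∧ t < T) :
    _root_.pdt (_root_.pd1 φ) ξ t = _root_.pd1 (_root_.pdt φ) ξ t := by
  have hs : IsSymmSndFDerivAt ℝ (fun p : ℝ × ℝ => φ p.1 p.2) (ξ, t) := by
    apply ContDiffAt.isSymmSndFDerivAt (n := ((⊤:ℕ∞) : WithTop ℕ∞)) (h.at' ht)
    simpa using two_le_top'
  set F := (fun p : ℝ × ℝ => φ p.1 p.2) with hF
  have hd : DifferentiableAt ℝ (fderiv ℝ F) (ξ, t) :=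
    ((h.at' (ξ := ξ) ht).fderiv_right (m := 1) (by rw [one_add_one_eq_two]; exact two_le_top')).differentiableAt (by simp)
  have hopen := (isOpen_Om T).mem_nhds (show (ξ,t) ∈ (Set.univ : Set ℝ) ×ˢ Set.Ioo (0:ℝ) T from ⟨mem_univ _, ht⟩)
  have e1 : _root_.pdt (_root_.pd1 φ) ξ t = fderiv ℝ (fderiv ℝ F) (ξ,t) (0,1) (1,0) := by
    rw [h.pd1.pdt_eq ht]
    have : (fun p : ℝ × ℝ => _root_.pd1 φ p.1 p.2) =ᶠ[𝓝 (ξ,t)] fun p => fderiv ℝ F p (1,0) := by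
      filter_upwards [hopen] with p hp using h.pd1_eq hp.2
    rw [this.fderiv_eq, fderiv_clm_apply hd (by fun_prop)]
    simp
  have e2 : _root_.pd1 (_root_.pdt φ) ξ t = fderiv ℝ (fderiv ℝ F) (ξ,t) (1,0) (0,1) := by
    rw [h.pdt.pd1_eq ht]
    have : (fun p : ℝ × ℝ => _root_.pdt φ p.1 p.2) =ᶠ[𝓝 (ξ,t)] fun p => fderiv ℝ F p (0,1) := by
      filter_upwards [hopen] with p hp using h.pdt_eq hp.2
    rw [this.fderiv_eq, fderiv_clm_apply hd (by fun_prop)]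
    simp
  rw [e1, e2]; exact hs.eq _ _

lemma hs (h : Sm T φ) (hp : ∀ ξ t, 0 < t → t < T → 0 < ρ ξ t) {ξ t : ℝ} (ht : 0 < t ∧ t < T) :
    HasDerivAt (fun y => φ y t) (ρ ξ t * _root_.Ds ρ φ ξ t) ξ := by
  have := (hp ξ t ht.1 ht.2).ne'
  refine (h.hx ht).congr_deriv ?_
  unfold _root_.Ds; field_simp

lemma commDs (h : Sm T φ) (hρ : Sm T ρ) (hp : ∀ ξ t, 0 < t → t < T → 0 < ρ ξ t)
    {ξ t : ℝ} (ht : 0 < t ∧ t < T) :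
    _root_.pdt (_root_.Ds ρ φ) ξ t = _root_.Ds ρ (_root_.pdt φ) ξ t
      - _root_.pdt ρ ξ t / ρ ξ t * _root_.Ds ρ φ ξ t := by
  have h0 := (hp ξ t ht.1 ht.2).ne'
  have h1 := ((h.pd1.htt (ξ := ξ) ht).div (hρ.htt (ξ := ξ) ht) h0).deriv
  have h2 : _root_.pdt (_root_.Ds ρ φ) ξ t = _ := h1
  rw [h2, h.comm ht]; unfold _root_.Ds; field_simp

end Sm

lemma Ds_of {ρ φ : ℝ → ℝ → ℝ} {ξ t d : ℝ} (hρ : 0 < ρ ξ t)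
    (h : HasDerivAt (fun y => φ y t) (ρ ξ t * d) ξ) : Ds ρ φ ξ t = d := by
  unfold Ds pd1; rw [h.deriv]; field_simp

lemma Ds_congr {ρ φ ψ : ℝ → ℝ → ℝ} {t : ℝ} (h : ∀ ξ, φ ξ t = ψ ξ t) (ξ : ℝ) :
    Ds ρ φ ξ t = Ds ρ ψ ξ t := by
  unfold Ds pd1
  have : (fun x => φ x t) = (fun x => ψ x t) := funext h
  rw [this]

lemma pdt_of {φ : ℝ → ℝ → ℝ} {ξ t d : ℝ} (h : HasDerivAt (fun τ => φ ξ τ) d t) : pdt φ ξ t = d :=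
  h.deriv
lemma Per.pd1 {φ : ℝ → ℝ → ℝ} (h : Per φ) : Per (pd1 φ) := by
  intro ξ t
  unfold _root_.pd1
  rw [← deriv_comp_add_const]
  congr 1; ext y; exact h y t

lemma Per.Ds {ρ φ : ℝ → ℝ → ℝ} (hρ : Per ρ) (h : Per φ) : Per (Ds ρ φ) := by
  intro ξ t; unfold _root_.Ds; rw [h.pd1 ξ t, hρ ξ t]

lemma Per.red {φ : ℝ → ℝ → ℝ} (h : Per φ) (ξ : ℝ) : ∃ y ∈ Icc (0:ℝ) (2*π), ∀ t, φ ξ t = φ y t := by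
  have hp : (0:ℝ) < 2*π := by positivity
  refine ⟨toIcoMod hp 0 ξ, ?_, fun t => ?_⟩
  · have := toIcoMod_mem_Ico hp 0 ξ
    exact ⟨this.1, by linarith [this.2]⟩
  · have hper : Function.Periodic (fun y => φ y t) (2*π) := fun y => h y t
    have e : toIcoMod hp 0 ξ = ξ - toIcoDiv hp 0 ξ • (2*π) := rfl
    rw [e]
    exact (hper.sub_zsmul_eq _).symm
end

section
set_option linter.unusedVariables false

lemma DsDs_crit {T : ℝ} {φ ρ : ℝ → ℝ → ℝ} (h : Sm T φ) (hρ : Sm T ρ)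
    (hp : ∀ ξ t, 0 < t → t < T → 0 < ρ ξ t) {ξ t : ℝ} (ht : 0 < t ∧ t < T)
    (hmax : ∀ y, φ y t ≤ φ ξ t) : Ds ρ φ ξ t = 0 ∧ Ds ρ (Ds ρ φ) ξ t ≤ 0 := by
  have h0 := hp ξ t ht.1 ht.2
  have hlm : IsLocalMax (fun y => φ y t) ξ := Eventually.of_forall hmax
  have h1 : pd1 φ ξ t = 0 := hlm.deriv_eq_zero
  refine ⟨by simp [Ds, h1], ?_⟩
  have h2 : Ds ρ (Ds ρ φ) ξ t = pd1 (pd1 φ) ξ t / ρ ξ t ^ 2 := by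
    have e := ((h.pd1.hx (ξ := ξ) ht).div (hρ.hx (ξ := ξ) ht) h0.ne')
    apply Ds_of h0
    refine HasDerivAt.congr_deriv e ?_
    rw [h1]; field_simp; ring
  rw [h2]
  by_contra hc
  push Not at hc
  have h3 : 0 < pd1 (pd1 φ) ξ t := by
    by_contra h4
    push Not at h4
    have : pd1 (pd1 φ) ξ t / ρ ξ t ^ 2 ≤ 0 := div_nonpos_of_nonpos_of_nonneg h4 (by positivity)
    linarith
  have hlmin : IsLocalMin (fun y => φ y t) ξ :=
    isLocalMin_of_deriv_deriv_pos (f := fun y => φ y t) h3 h1 (h.hx ht).continuousAt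
  have hconst : (fun y => φ y t) =ᶠ[𝓝 ξ] fun _ => φ ξ t := by
    filter_upwards [hlmin] with y hy using le_antisymm (hmax y) hy
  have hd : (deriv (fun y => φ y t)) =ᶠ[𝓝 ξ] deriv (fun _ => φ ξ t) := hconst.deriv
  have : pd1 (pd1 φ) ξ t = deriv (deriv (fun _ : ℝ => φ ξ t)) ξ := hd.deriv_eq
  simp at this
  linarith

lemma slab_cont {T : ℝ} {φ : ℝ → ℝ → ℝ} (h : Sm T φ) {a b : ℝ} (ha : 0 < a) (hb : b < T) :
    ContinuousOn (fun p : ℝ × ℝ => φ p.1 p.2) (Icc (0:ℝ) (2*π) ×ˢ Icc a b) :=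
  h.cont.mono (fun p hp => ⟨mem_univ _, lt_of_lt_of_le ha hp.2.1, lt_of_le_of_lt hp.2.2 hb⟩)

lemma slab_compact (a b : ℝ) : IsCompact (Icc (0:ℝ) (2*π) ×ˢ Icc a b) :=
  isCompact_Icc.prod isCompact_Icc

theorem maxP {T : ℝ} {φ ρ : ℝ → ℝ → ℝ} (h : Sm T φ) (hper : Per φ) (hρ : Sm T ρ)
    (hp : ∀ ξ t, 0 < t → t < T → 0 < ρ ξ t) {t0 c : ℝ} (ht0 : 0 < t0)
    (h0 : ∀ ξ, φ ξ t0 < c)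
    (H : ∀ ξ t, t0 < t → t < T → φ ξ t = c → (∀ y, φ y t ≤ c) → Ds ρ φ ξ t = 0 →
      Ds ρ (Ds ρ φ) ξ t ≤ 0 → pdt φ ξ t < 0) :
    ∀ ξ t, t0 ≤ t → t < T → φ ξ t < c := by
  intro ξ t' ht' hT
  by_contra hc
  push Not at hc
  let K : Set (ℝ × ℝ) := {p ∈ Icc (0:ℝ) (2*π) ×ˢ Icc t0 t' | c ≤ φ p.1 p.2}
  have hK : IsCompact K := by
    apply (slab_compact t0 t').of_isClosed_subset _ (fun p hp => hp.1)
    exact (slab_cont h ht0 hT).preimage_isClosed_of_isClosed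
      ((slab_compact t0 t').isClosed) isClosed_Ici
  obtain ⟨y0, hy0, hy0e⟩ := hper.red ξ
  have hne : K.Nonempty := ⟨(y0, t'), ⟨hy0, ⟨ht', le_rfl⟩⟩, by simpa [← hy0e] using hc⟩
  obtain ⟨⟨ξ1, t1⟩, hm, hmin⟩ := hK.exists_isMinOn hne continuous_snd.continuousOn
  obtain ⟨⟨hξ1, ht1⟩, hge⟩ := hm
  simp only at hξ1 ht1 hge
  have hlt : t0 < t1 := by
    rcases lt_or_eq_of_le ht1.1 with h1 | h1
    · exact h1
    · exfalso; have := h0 ξ1; rw [h1] at this; linarith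
  have ht1T : 0 < t1 ∧ t1 < T := ⟨by linarith, by linarith [ht1.2]⟩
  have hbefore : ∀ y t, t0 ≤ t → t < t1 → φ y t < c := by
    intro y t hta htb
    by_contra hcc
    push Not at hcc
    obtain ⟨y1, hy1, hy1e⟩ := hper.red y
    have hmem : (y1, t) ∈ K := ⟨⟨hy1, ⟨hta, by linarith [ht1.2]⟩⟩, by simpa [← hy1e] using hcc⟩
    have := hmin hmem
    simp at this; linarith
  have hev : ∀ y, ∀ᶠ t in 𝓝[<] t1, φ y t < c := by
    intro y
    filter_upwards [Ioo_mem_nhdsLT hlt] with t ht using hbefore y t ht.1.le ht.2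
  have hle : ∀ y, φ y t1 ≤ c := by
    intro y
    have hcont : Tendsto (fun τ => φ y τ) (𝓝[<] t1) (𝓝 (φ y t1)) :=
      ((h.htt (ξ := y) ht1T).continuousAt).tendsto.mono_left nhdsWithin_le_nhds
    exact le_of_tendsto hcont ((hev y).mono fun _ h => h.le)
  have heq : φ ξ1 t1 = c := le_antisymm (hle ξ1) hge
  obtain ⟨hd1, hd2⟩ := DsDs_crit h hρ hp ht1T (ξ := ξ1) (fun y => by rw [heq]; exact hle y)
  have hneg := H ξ1 t1 hlt ht1T.2 heq hle hd1 hd2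
  have hslope := (hasDerivAt_iff_tendsto_slope.1 (h.htt (ξ := ξ1) ht1T))
  have h5 : ∀ᶠ t in 𝓝[<] t1, slope (fun τ => φ ξ1 τ) t1 t < 0 :=
    (hslope.mono_left (nhdsWithin_mono _ (fun x hx => ne_of_lt hx))).eventually_lt_const hneg
  obtain ⟨t, ht5, ht6, ht7⟩ := (h5.and ((hev ξ1).and self_mem_nhdsWithin)).exists
  rw [slope_def_field, heq] at ht5
  have : 0 ≤ (φ ξ1 t - c) / (t - t1) :=
    div_nonneg_of_nonpos (by linarith) (by have : t < t1 := ht7; linarith)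
  linarith

lemma exists_min {T : ℝ} {φ : ℝ → ℝ → ℝ} (h : Sm T φ) (hper : Per φ) {t : ℝ} (ht : 0 < t ∧ t < T) :
    ∃ ξ, ∀ y, φ ξ t ≤ φ y t := by
  have hc : ContinuousOn (fun y => φ y t) (Icc (0:ℝ) (2*π)) := fun y _ =>
    (h.hx ht).continuousAt.continuousWithinAt
  obtain ⟨ξ, _, hξ⟩ := isCompact_Icc.exists_isMinOn (nonempty_Icc.2 (by positivity)) hc
  refine ⟨ξ, fun y => ?_⟩
  obtain ⟨y1, hy1, hy1e⟩ := hper.red y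
  rw [hy1e]; exact hξ hy1

lemma exists_bd {T : ℝ} {φ : ℝ → ℝ → ℝ} (h : Sm T φ) (hper : Per φ) {t : ℝ} (ht : 0 < t ∧ t < T) :
    ∃ C, 0 < C ∧ ∀ y, φ y t < C := by
  obtain ⟨ξ, hξ⟩ := exists_min h.neg (fun a b => by simp [hper a b]) ht
  refine ⟨|φ ξ t| + 1, by positivity, fun y => ?_⟩
  have := hξ y; have := le_abs_self (φ ξ t); linarith

theorem minP {T : ℝ} {φ : ℝ → ℝ → ℝ} (h : Sm T φ) (hper : Per φ) {t0 c : ℝ} (ht0 : 0 < t0)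
    (h0 : ∃ ξ, φ ξ t0 ≤ c)
    (H : ∀ ξ t, t0 ≤ t → t < T → φ ξ t ≤ c → (∀ y, φ ξ t ≤ φ y t) → pdt φ ξ t < 0) :
    ∀ t, t0 ≤ t → t < T → ∃ ξ, φ ξ t ≤ c := by
  intro t' ht' hT
  let K : Set (ℝ × ℝ) := {p ∈ Icc (0:ℝ) (2*π) ×ˢ Icc t0 t' | φ p.1 p.2 ≤ c}
  have hK : IsCompact K := by
    apply (slab_compact t0 t').of_isClosed_subset _ (fun p hp => hp.1)
    exact (slab_cont h ht0 hT).preimage_isClosed_of_isClosed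
      ((slab_compact t0 t').isClosed) isClosed_Iic
  obtain ⟨ξ0, hξ0⟩ := h0
  obtain ⟨y0, hy0, hy0e⟩ := hper.red ξ0
  have hne : K.Nonempty := ⟨(y0, t0), ⟨hy0, ⟨le_rfl, ht'⟩⟩, by simpa [← hy0e] using hξ0⟩
  obtain ⟨⟨ξ1, t1⟩, hm, hmax⟩ := hK.exists_isMaxOn hne continuous_snd.continuousOn
  obtain ⟨⟨hξ1, ht1⟩, hge⟩ := hm
  simp only at hξ1 ht1 hge
  rcases eq_or_lt_of_le ht1.2 with he | hlt
  · exact ⟨ξ1, by rw [← he]; exact hge⟩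
  exfalso
  have ht1T : 0 < t1 ∧ t1 < T := ⟨by linarith [ht1.1], by linarith⟩
  obtain ⟨ξ2, hξ2⟩ := exists_min h hper ht1T
  have hle2 : φ ξ2 t1 ≤ c := (hξ2 ξ1).trans hge
  have hneg := H ξ2 t1 ht1.1 ht1T.2 hle2 hξ2
  have hslope := (hasDerivAt_iff_tendsto_slope.1 (h.htt (ξ := ξ2) ht1T))
  have h5 : ∀ᶠ t in 𝓝[>] t1, slope (fun τ => φ ξ2 τ) t1 t < 0 :=
    (hslope.mono_left (nhdsWithin_mono _ (fun x hx => ne_of_gt hx))).eventually_lt_const hneg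
  obtain ⟨t, ht5, ht6⟩ := (h5.and (Ioo_mem_nhdsGT hlt)).exists
  rw [slope_def_field] at ht5
  have h7 : φ ξ2 t < c := by
    by_contra h8
    push Not at h8
    have : 0 ≤ (φ ξ2 t - φ ξ2 t1) / (t - t1) := div_nonneg (by linarith) (by linarith [ht6.1])
    linarith
  obtain ⟨y1, hy1, hy1e⟩ := hper.red ξ2
  have hmem : (y1, t) ∈ K := ⟨⟨hy1, ⟨by linarith [ht6.1, ht1.1], ht6.2.le⟩⟩, by
    simpa [← hy1e] using h7.le⟩
  have := hmax hmem
  simp at this; linarith [ht6.1]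
end

section
set_option linter.unusedVariables false

structure HD (T : ℝ) (ρ φ a b : ℝ → ℝ → ℝ) : Prop where
  sm : Sm T φ
  s : ∀ ξ t, 0 < t ∧ t < T → HasDerivAt (fun y => φ y t) (ρ ξ t * a ξ t) ξ
  t : ∀ ξ t, 0 < t ∧ t < T → HasDerivAt (fun τ => φ ξ τ) (b ξ t) t

namespace HD
variable {T : ℝ} {ρ φ ψ a b c d : ℝ → ℝ → ℝ}

lemma base (hρ : Sm T ρ) (hp : ∀ ξ t, 0 < t → t < T → 0 < ρ ξ t) (h : Sm T φ) :
    HD T ρ φ (Ds ρ φ) (pdt φ) :=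
  ⟨h, fun ξ t ht => h.hs hp ht, fun ξ t ht => h.htt ht⟩

lemma add (h : HD T ρ φ a b) (h' : HD T ρ ψ c d) :
    HD T ρ (fun ξ t => φ ξ t + ψ ξ t) (fun ξ t => a ξ t + c ξ t) (fun ξ t => b ξ t + d ξ t) :=
  ⟨h.sm.add h'.sm, fun ξ t ht => ((h.s ξ t ht).add (h'.s ξ t ht)).congr_deriv (by ring),
    fun ξ t ht => (h.t ξ t ht).add (h'.t ξ t ht)⟩

lemma sub (h : HD T ρ φ a b) (h' : HD T ρ ψ c d) :
    HD T ρ (fun ξ t => φ ξ t - ψ ξ t) (fun ξ t => a ξ t - c ξ t) (fun ξ t => b ξ t - d ξ t) :=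
  ⟨h.sm.sub h'.sm, fun ξ t ht => ((h.s ξ t ht).sub (h'.s ξ t ht)).congr_deriv (by ring),
    fun ξ t ht => (h.t ξ t ht).sub (h'.t ξ t ht)⟩

lemma mul (h : HD T ρ φ a b) (h' : HD T ρ ψ c d) :
    HD T ρ (fun ξ t => φ ξ t * ψ ξ t) (fun ξ t => a ξ t * ψ ξ t + φ ξ t * c ξ t)
      (fun ξ t => b ξ t * ψ ξ t + φ ξ t * d ξ t) :=
  ⟨h.sm.mul h'.sm, fun ξ t ht => ((h.s ξ t ht).mul (h'.s ξ t ht)).congr_deriv (by ring),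
    fun ξ t ht => (h.t ξ t ht).mul (h'.t ξ t ht)⟩

lemma cmul (k : ℝ) (h : HD T ρ φ a b) :
    HD T ρ (fun ξ t => k * φ ξ t) (fun ξ t => k * a ξ t) (fun ξ t => k * b ξ t) :=
  ⟨(Sm.const k).mul h.sm, fun ξ t ht => ((h.s ξ t ht).const_mul k).congr_deriv (by ring),
    fun ξ t ht => (h.t ξ t ht).const_mul k⟩

lemma addc (k : ℝ) (h : HD T ρ φ a b) :
    HD T ρ (fun ξ t => φ ξ t + k) a b :=
  ⟨h.sm.add (Sm.const k), fun ξ t ht => (h.s ξ t ht).add_const k,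
    fun ξ t ht => (h.t ξ t ht).add_const k⟩

lemma addct (k : ℝ) (h : HD T ρ φ a b) :
    HD T ρ (fun ξ t => φ ξ t + k * t) a (fun ξ t => b ξ t + k) :=
  ⟨h.sm.add ((Sm.const k).mul Sm.time), fun ξ t ht => (h.s ξ t ht).add_const (k*t),
    fun ξ t ht => ((h.t ξ t ht).add ((hasDerivAt_id t).const_mul k)).congr_deriv (by simp)⟩

lemma sq (h : HD T ρ φ a b) :
    HD T ρ (fun ξ t => φ ξ t ^ 2) (fun ξ t => 2 * φ ξ t * a ξ t) (fun ξ t => 2 * φ ξ t * b ξ t) :=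
  ⟨h.sm.pow 2, fun ξ t ht => ((h.s ξ t ht).pow 2).congr_deriv (by simp; ring),
    fun ξ t ht => ((h.t ξ t ht).pow 2).congr_deriv (by simp)⟩

lemma exp (h : HD T ρ φ a b) :
    HD T ρ (fun ξ t => Real.exp (φ ξ t)) (fun ξ t => a ξ t * Real.exp (φ ξ t))
      (fun ξ t => b ξ t * Real.exp (φ ξ t)) :=
  ⟨h.sm.exp, fun ξ t ht => ((h.s ξ t ht).exp).congr_deriv (by ring),
    fun ξ t ht => ((h.t ξ t ht).exp).congr_deriv (by ring)⟩

lemma comp (F F' : ℝ → ℝ) (hF : ∀ x, HasDerivAt F (F' x) x) (hc : ContDiff ℝ (⊤:ℕ∞) F)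
    (h : HD T ρ φ a b) :
    HD T ρ (fun ξ t => F (φ ξ t)) (fun ξ t => F' (φ ξ t) * a ξ t)
      (fun ξ t => F' (φ ξ t) * b ξ t) :=
  ⟨hc.comp_contDiffOn h.sm, fun ξ t ht => ((hF (φ ξ t)).comp ξ (h.s ξ t ht)).congr_deriv (by ring),
    fun ξ t ht => ((hF (φ ξ t)).comp t (h.t ξ t ht))⟩

lemma cg (h : HD T ρ φ a b) (ha : ∀ ξ t, 0 < t ∧ t < T → a ξ t = c ξ t)
    (hb : ∀ ξ t, 0 < t ∧ t < T → b ξ t = d ξ t) : HD T ρ φ c d :=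
  ⟨h.sm, fun ξ t ht => by rw [← ha ξ t ht]; exact h.s ξ t ht,
    fun ξ t ht => by rw [← hb ξ t ht]; exact h.t ξ t ht⟩

lemma ds (h : HD T ρ φ a b) (hp : ∀ ξ t, 0 < t → t < T → 0 < ρ ξ t) {ξ t : ℝ}
    (ht : 0 < t ∧ t < T) : Ds ρ φ ξ t = a ξ t := Ds_of (hp ξ t ht.1 ht.2) (h.s ξ t ht)

lemma dt (h : HD T ρ φ a b) {ξ t : ℝ} (ht : 0 < t ∧ t < T) : pdt φ ξ t = b ξ t :=
  pdt_of (h.t ξ t ht)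

lemma dss (h : HD T ρ φ a b) (h' : HD T ρ a c d) (hp : ∀ ξ t, 0 < t → t < T → 0 < ρ ξ t) {ξ t : ℝ}
    (ht : 0 < t ∧ t < T) : Ds ρ (Ds ρ φ) ξ t = c ξ t := by
  rw [Ds_congr (ψ := a) (fun y => h.ds hp ht), h'.ds hp ht]

theorem max (h : HD T ρ φ a b) (h' : HD T ρ a c d) (hper : Per φ) (hρ : Sm T ρ)
    (hp : ∀ ξ t, 0 < t → t < T → 0 < ρ ξ t) {t0 A : ℝ} (ht0 : 0 < t0)
    (h0 : ∀ ξ, φ ξ t0 < A)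
    (H : ∀ ξ t, 0 < t ∧ t < T → t0 < t → φ ξ t = A → a ξ t = 0 →
      c ξ t ≤ 0 → b ξ t < 0) :
    ∀ ξ t, t0 ≤ t → t < T → φ ξ t < A := by
  apply maxP h.sm hper hρ hp ht0 h0
  intro ξ t h1 h2 h3 h4 h5 h6
  have ht : 0 < t ∧ t < T := ⟨ht0.trans h1, h2⟩
  rw [h.dt ht]
  rw [h.ds hp ht] at h5
  rw [h.dss h' hp ht] at h6
  exact H ξ t ht h1 h3 h5 h6
end HD

def Ph (v : ℝ) : ℝ := (8 * rexp (2*v/3) - 2 * rexp (8*v/3))/3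
def Ps (v : ℝ) : ℝ := 4 * (rexp (2*v/3) - rexp (8*v/3))
def Ps1 (v : ℝ) : ℝ := 4 * ((2/3) * rexp (2*v/3) - (8/3) * rexp (8*v/3))
def Ps2 (v : ℝ) : ℝ := 4 * ((4/9) * rexp (2*v/3) - (64/9) * rexp (8*v/3))

lemma hde (c : ℝ) (x : ℝ) : HasDerivAt (fun v : ℝ => rexp (c*v/3)) (c/3 * rexp (c*x/3)) x := by
  have : HasDerivAt (fun v : ℝ => c*v/3) (c/3) x := by
    simpa using ((hasDerivAt_id x).const_mul c).div_const 3
  exact this.exp.congr_deriv (by ring)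

lemma hPh (x : ℝ) : HasDerivAt Ph ((fun v => 4/9 * Ps v) x) x :=
  ((((hde 2 x).const_mul 8).sub ((hde 8 x).const_mul 2)).div_const 3).congr_deriv (by
    simp only [Ps]; ring1)
lemma hPs (x : ℝ) : HasDerivAt Ps (Ps1 x) x :=
  (((hde 2 x).sub (hde 8 x)).const_mul 4).congr_deriv (by
    simp only [Ps1])
lemma hPs1 (x : ℝ) : HasDerivAt Ps1 (Ps2 x) x :=
  ((((hde 2 x).const_mul (2/3)).sub ((hde 8 x).const_mul (8/3))).const_mul 4).congr_deriv (by
    simp only [Ps2]; ring)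
lemma cPh : ContDiff ℝ (⊤:ℕ∞) Ph := by unfold Ph; fun_prop
lemma cPs : ContDiff ℝ (⊤:ℕ∞) Ps := by unfold Ps; fun_prop
lemma cPs1 : ContDiff ℝ (⊤:ℕ∞) Ps1 := by unfold Ps1; fun_prop

structure Sys (T : ℝ) (x v ρ : ℝ → ℝ → ℝ) : Prop where
  Tp : 0 < T
  sx : Sm T x
  sv : Sm T v
  sρ : Sm T ρ
  hp : ∀ ξ t, 0 < t → t < T → 0 < ρ ξ t
  px : Per x
  pv : Per v
  pρ : Per ρ
  ex : ∀ ξ t, 0 < t ∧ t < T → pdt x ξ t = Ds ρ (Ds ρ x) ξ t + 3 * Ds ρ x ξ t ^ 2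
    - Ph (v ξ t) * rexp (-2 * x ξ t)
  ev : ∀ ξ t, 0 < t ∧ t < T → pdt v ξ t = Ds ρ (Ds ρ v) ξ t + 3 * (Ds ρ x ξ t * Ds ρ v ξ t)
    + Ps (v ξ t) * rexp (-2 * x ξ t)
  eρ : ∀ ξ t, 0 < t ∧ t < T → pdt ρ ξ t / ρ ξ t =
    3 * (Ds ρ (Ds ρ x) ξ t + Ds ρ x ξ t ^ 2) + 2/3 * Ds ρ v ξ t ^ 2

section
variable {T : ℝ} {f g ρ : ℝ → ℝ → ℝ}

def xx (f g : ℝ → ℝ → ℝ) (ξ t : ℝ) : ℝ := (1/3) * (Real.log (f ξ t) + 2 * Real.log (g ξ t))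
def vv (f g : ℝ → ℝ → ℝ) (ξ t : ℝ) : ℝ := Real.log (f ξ t) - Real.log (g ξ t)

lemma HD.log {T : ℝ} {ρ φ a b : ℝ → ℝ → ℝ} (h : HD T ρ φ a b)
    (hp : ∀ ξ t, 0 < t → t < T → 0 < φ ξ t) :
    HD T ρ (fun ξ t => Real.log (φ ξ t)) (fun ξ t => a ξ t / φ ξ t) (fun ξ t => b ξ t / φ ξ t) :=
  ⟨h.sm.log hp, fun ξ t ht => ((h.s ξ t ht).log (hp ξ t ht.1 ht.2).ne').congr_deriv (by ring),
    fun ξ t ht => ((h.t ξ t ht).log (hp ξ t ht.1 ht.2).ne')⟩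

lemma HD.div {T : ℝ} {ρ φ ψ a b c d : ℝ → ℝ → ℝ} (h : HD T ρ φ a b) (h' : HD T ρ ψ c d)
    (hp : ∀ ξ t, 0 < t → t < T → 0 < ψ ξ t) :
    HD T ρ (fun ξ t => φ ξ t / ψ ξ t) (fun ξ t => (a ξ t * ψ ξ t - φ ξ t * c ξ t) / ψ ξ t ^ 2)
     (fun ξ t => (b ξ t * ψ ξ t - φ ξ t * d ξ t) / ψ ξ t ^ 2) :=
  ⟨h.sm.div h'.sm hp, fun ξ t ht => ((h.s ξ t ht).div (h'.s ξ t ht) (hp ξ t ht.1 ht.2).ne').congr_deriv (by ring),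
    fun ξ t ht => ((h.t ξ t ht).div (h'.t ξ t ht) (hp ξ t ht.1 ht.2).ne')⟩

structure GeoRel (ρ f g : ℝ → ℝ → ℝ) (ξ t x1 x2 v1 v2 : ℝ) : Prop where
  f1 : Ds ρ f ξ t = f ξ t * (x1 + 2/3 * v1)
  g1 : Ds ρ g ξ t = g ξ t * (x1 - 1/3 * v1)
  f2 : Ds ρ (Ds ρ f) ξ t = f ξ t * (x2 + 2/3 * v2 + (x1 + 2/3 * v1)^2)
  g2 : Ds ρ (Ds ρ g) ξ t = g ξ t * (x2 - 1/3 * v2 + (x1 - 1/3 * v1)^2)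

lemma fexp (hf : 0 < f ξ t) (hg : 0 < g ξ t) :
    f ξ t = rexp (xx f g ξ t) * rexp (2 * vv f g ξ t / 3) ∧
    g ξ t = rexp (xx f g ξ t) * rexp (- vv f g ξ t / 3) := by
  constructor
  · rw [← Real.exp_add]
    conv_lhs => rw [← Real.exp_log hf]
    congr 1; unfold xx vv; ring
  · rw [← Real.exp_add]
    conv_lhs => rw [← Real.exp_log hg]
    congr 1; unfold xx vv; ring

lemma mkSys (sol : WarpedBerger T f g ρ) : Sys T (xx f g) (vv f g) ρ ∧
    ∀ ξ t, 0 < t ∧ t < T → GeoRel ρ f g ξ t (Ds ρ (xx f g) ξ t) (Ds ρ (Ds ρ (xx f g)) ξ t)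
      (Ds ρ (vv f g) ξ t) (Ds ρ (Ds ρ (vv f g)) ξ t) := by
  have hS := sol.smooth.mono (show (univ : Set ℝ) ×ˢ Ioo 0 T ⊆ univ ×ˢ Ico 0 T from
    prod_mono le_rfl Ioo_subset_Ico_self)
  have sf : Sm T f := hS.fst
  have sg : Sm T g := hS.snd.fst
  have sρ : Sm T ρ := hS.snd.snd
  have fp : ∀ ξ t, 0 < t → t < T → 0 < f ξ t := fun ξ t h => sol.f_pos ξ t h.le
  have gp : ∀ ξ t, 0 < t → t < T → 0 < g ξ t := fun ξ t h => sol.g_pos ξ t h.le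
  have hp : ∀ ξ t, 0 < t → t < T → 0 < ρ ξ t := fun ξ t h => sol.ρ_pos ξ t h.le
  have hf := HD.base sρ hp sf
  have hg := HD.base sρ hp sg
  have hf1 := HD.base sρ hp (sf.Ds sρ hp)
  have hg1 := HD.base sρ hp (sg.Ds sρ hp)
  have hx : HD T ρ (xx f g) _ _ := ((hf.log fp).add ((hg.log gp).cmul 2)).cmul (1/3)
  have hv : HD T ρ (vv f g) _ _ := (hf.log fp).sub (hg.log gp)
  have hx1 := ((hf1.div hf fp).add ((hg1.div hg gp).cmul 2)).cmul (1/3)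
  have hv1 := (hf1.div hf fp).sub (hg1.div hg gp)
  have E : ∀ ξ t, 0 < t ∧ t < T → Ph (vv f g ξ t) * rexp (-2 * xx f g ξ t) =
      (8 * g ξ t ^2 - 2 * f ξ t ^ 2)/3 / g ξ t ^ 4 ∧ 
      Ps (vv f g ξ t) * rexp (-2 * xx f g ξ t) =
      4 * (g ξ t ^2 - f ξ t ^ 2) / g ξ t ^ 4 := by
    intro ξ t ht
    have h1 := (fp ξ t ht.1 ht.2); have h2 := (gp ξ t ht.1 ht.2)
    obtain ⟨e1, e2⟩ := fexp h1 h2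
    have eg : ∀ n : ℕ, g ξ t ^ n = rexp (n * Real.log (g ξ t)) := fun n => by
      rw [Real.exp_nat_mul, Real.exp_log h2]
    have ef : ∀ n : ℕ, f ξ t ^ n = rexp (n * Real.log (f ξ t)) := fun n => by
      rw [Real.exp_nat_mul, Real.exp_log h1]
    have a1 : rexp (2 * vv f g ξ t/3) * rexp (-2 * xx f g ξ t) = 1 / g ξ t ^ 2 := by
      rw [eq_div_iff (by positivity)]
      rw [eg 2, ← Real.exp_add, ← Real.exp_add]
      rw [Real.exp_eq_one_iff]; unfold xx vv; push_cast; ring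
    have a2 : rexp (8 * vv f g ξ t/3) * rexp (-2 * xx f g ξ t) = f ξ t ^ 2 / g ξ t ^ 4 := by
      rw [eq_div_iff (by positivity)]
      rw [eg 4, ef 2, ← Real.exp_add, ← Real.exp_add]
      congr 1; unfold xx vv; push_cast; ring
    constructor
    · rw [show Ph (vv f g ξ t) * rexp (-2 * xx f g ξ t) = (8 * (rexp (2 * vv f g ξ t/3) * rexp (-2 * xx f g ξ t)) - 2 * (rexp (8 * vv f g ξ t/3) * rexp (-2 * xx f g ξ t)))/3 by unfold Ph; ring, a1, a2]
      field_simp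
    · rw [show Ps (vv f g ξ t) * rexp (-2 * xx f g ξ t) = 4 * ((rexp (2 * vv f g ξ t/3) * rexp (-2 * xx f g ξ t)) - (rexp (8 * vv f g ξ t/3) * rexp (-2 * xx f g ξ t))) by unfold Ps; ring, a1, a2]
      field_simp
  refine ⟨⟨sol.T_pos, hx.sm, hv.sm, sρ, hp, ?_, ?_, sol.ρ_per, ?_, ?_, ?_⟩, ?_⟩
  · intro ξ t; simp only [xx, sol.f_per, sol.g_per]
  · intro ξ t; simp only [vv, sol.f_per, sol.g_per]
  · intro ξ t ht
    have h1 := (fp ξ t ht.1 ht.2); have h2 := (gp ξ t ht.1 ht.2)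
    rw [hx.dt ht, hx.ds hp ht, hx.dss hx1 hp ht, (E ξ t ht).1]
    rw [sol.eq_f ξ t ht.1 ht.2, sol.eq_g ξ t ht.1 ht.2]
    field_simp; ring
  · intro ξ t ht
    have h1 := (fp ξ t ht.1 ht.2); have h2 := (gp ξ t ht.1 ht.2)
    rw [hv.dt ht, hx.ds hp ht, hv.ds hp ht, hv.dss hv1 hp ht, (E ξ t ht).2]
    rw [sol.eq_f ξ t ht.1 ht.2, sol.eq_g ξ t ht.1 ht.2]
    field_simp; ring
  · intro ξ t ht
    have h1 := (fp ξ t ht.1 ht.2); have h2 := (gp ξ t ht.1 ht.2)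
    have h3 := ((HD.base sρ hp sρ).log hp).dt (ξ := ξ) ht
    rw [← h3, sol.eq_ρ ξ t ht.1 ht.2, hx.ds hp ht, hx.dss hx1 hp ht, hv.ds hp ht]
    field_simp; ring
  · intro ξ t ht
    have h1 := (fp ξ t ht.1 ht.2); have h2 := (gp ξ t ht.1 ht.2)
    rw [hx.ds hp ht, hx.dss hx1 hp ht, hv.ds hp ht, hv.dss hv1 hp ht]
    constructor <;> (field_simp; try ring)
end
end

section
set_option linter.unusedVariables false

def ZZ (ρ x : ℝ → ℝ → ℝ) (ξ t : ℝ) : ℝ := rexp (2 * x ξ t) * Ds ρ x ξ t ^ 2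
def WW (ρ x v : ℝ → ℝ → ℝ) (ξ t : ℝ) : ℝ := rexp (2 * x ξ t) * Ds ρ v ξ t ^ 2
def DD (ρ x : ℝ → ℝ → ℝ) (ξ t : ℝ) : ℝ := rexp (2 * x ξ t) * (Ds ρ (Ds ρ x) ξ t + Ds ρ x ξ t ^ 2)
def VV (ρ x v : ℝ → ℝ → ℝ) (ξ t : ℝ) : ℝ := rexp (2 * x ξ t) * Ds ρ (Ds ρ v) ξ t
def PP (ρ x v : ℝ → ℝ → ℝ) (ξ t : ℝ) : ℝ := rexp (2 * x ξ t) * (Ds ρ x ξ t * Ds ρ v ξ t)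

namespace Sys
variable {T : ℝ} {x v ρ : ℝ → ℝ → ℝ}

lemma b (S : Sys T x v ρ) {φ : ℝ → ℝ → ℝ} (h : Sm T φ) : HD T ρ φ (Ds ρ φ) (pdt φ) :=
  HD.base S.sρ S.hp h
lemma d (S : Sys T x v ρ) {φ : ℝ → ℝ → ℝ} (h : Sm T φ) : Sm T (Ds ρ φ) := h.Ds S.sρ S.hp

lemma x0 (S : Sys T x v ρ) : HD T ρ x (Ds ρ x) (fun ξ t => Ds ρ (Ds ρ x) ξ t + 3 * Ds ρ x ξ t ^ 2
    - Ph (v ξ t) * rexp (-2 * x ξ t)) := (S.b S.sx).cg (fun _ _ _ => rfl) S.ex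
lemma v0 (S : Sys T x v ρ) : HD T ρ v (Ds ρ v) (fun ξ t => Ds ρ (Ds ρ v) ξ t
    + 3 * (Ds ρ x ξ t * Ds ρ v ξ t) + Ps (v ξ t) * rexp (-2 * x ξ t)) :=
  (S.b S.sv).cg (fun _ _ _ => rfl) S.ev

lemma nx (S : Sys T x v ρ) {φ a b F F1 q : ℝ → ℝ → ℝ} (h : Sm T φ)
    (hF : ∀ ξ t, 0 < t ∧ t < T → pdt φ ξ t = F ξ t) (h1 : HD T ρ F F1 q) :
    HD T ρ (Ds ρ φ) (Ds ρ (Ds ρ φ)) (fun ξ t => F1 ξ t -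
      (3 * (Ds ρ (Ds ρ x) ξ t + Ds ρ x ξ t ^ 2) + 2/3 * Ds ρ v ξ t ^ 2) * Ds ρ φ ξ t) := by
  refine (S.b (S.d h)).cg (fun _ _ _ => rfl) ?_
  intro ξ t ht
  rw [h.commDs S.sρ S.hp ht, Ds_congr (ψ := F) (fun y => hF y t ht), h1.ds S.hp ht, S.eρ ξ t ht]

lemma x1 (S : Sys T x v ρ) : HD T ρ (Ds ρ x) (Ds ρ (Ds ρ x)) (fun ξ t => Ds ρ (Ds ρ (Ds ρ x)) ξ t
    + 3 * (Ds ρ x ξ t * Ds ρ (Ds ρ x) ξ t) - 3 * (Ds ρ x ξ t * Ds ρ x ξ t ^ 2)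
      - 2/3 * (Ds ρ v ξ t ^ 2 * Ds ρ x ξ t)
     + (2 * (Ph (v ξ t) * Ds ρ x ξ t) - 4/9 * (Ps (v ξ t) * Ds ρ v ξ t)) * rexp (-2 * x ξ t)) := by
  have hF := ((S.b (S.d (S.d S.sx))).add ((S.b (S.d S.sx)).sq.cmul 3)).sub
    ((S.v0.comp Ph _ hPh cPh).mul (S.x0.cmul (-2)).exp)
  refine (S.nx S.sx S.ex hF (a := x) (b := x)).cg (fun _ _ _ => rfl) ?_
  intro ξ t ht
  ring

lemma v1 (S : Sys T x v ρ) : HD T ρ (Ds ρ v) (Ds ρ (Ds ρ v)) (fun ξ t => Ds ρ (Ds ρ (Ds ρ v)) ξ t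
    + 3 * (Ds ρ x ξ t * Ds ρ (Ds ρ v) ξ t) - 3 * (Ds ρ x ξ t ^ 2 * Ds ρ v ξ t)
      - 2/3 * (Ds ρ v ξ t ^ 2 * Ds ρ v ξ t)
     + (Ps1 (v ξ t) * Ds ρ v ξ t - 2 * (Ps (v ξ t) * Ds ρ x ξ t)) * rexp (-2 * x ξ t)) := by
  have hF := ((S.b (S.d (S.d S.sv))).add (((S.b (S.d S.sx)).mul (S.b (S.d S.sv))).cmul 3)).add
    ((S.v0.comp Ps _ hPs cPs).mul (S.x0.cmul (-2)).exp)
  refine (S.nx S.sv S.ev hF (a := x) (b := x)).cg (fun _ _ _ => rfl) ?_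
  intro ξ t ht
  ring

lemma x2 (S : Sys T x v ρ) : ∃ q, HD T ρ (Ds ρ (Ds ρ x)) (Ds ρ (Ds ρ (Ds ρ x))) q ∧
   ∀ ξ t, 0 < t ∧ t < T → q ξ t = 
   Ds ρ (Ds ρ (Ds ρ (Ds ρ x))) ξ t
    + 3 * (Ds ρ (Ds ρ x) ξ t ^ 2 + Ds ρ x ξ t * Ds ρ (Ds ρ (Ds ρ x)) ξ t)
    - 9 * (Ds ρ x ξ t ^ 2 * Ds ρ (Ds ρ x) ξ t)
      - 2/3 * (Ds ρ v ξ t ^ 2 * Ds ρ (Ds ρ x) ξ t + 2 * Ds ρ v ξ t * Ds ρ (Ds ρ v) ξ t * Ds ρ x ξ t)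
     + (2 * (Ph (v ξ t) * Ds ρ (Ds ρ x) ξ t) + 8/9 * (Ps (v ξ t) * Ds ρ v ξ t * Ds ρ x ξ t)
       - 4/9 * (Ps (v ξ t) * Ds ρ (Ds ρ v) ξ t + Ps1 (v ξ t) * Ds ρ v ξ t ^ 2)
        - 2 * Ds ρ x ξ t * (2 * (Ph (v ξ t) * Ds ρ x ξ t) - 4/9 * (Ps (v ξ t) * Ds ρ v ξ t))) * rexp (-2 * x ξ t)
      - (3 * (Ds ρ (Ds ρ x) ξ t + Ds ρ x ξ t ^ 2) + 2/3 * Ds ρ v ξ t ^ 2) * Ds ρ (Ds ρ x) ξ t := by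
  have X1 := S.b (S.d S.sx)
  have V1 := S.b (S.d S.sv)
  have X2 := S.b (S.d (S.d S.sx))
  have X3 := S.b (S.d (S.d (S.d S.sx)))
  have hF := (((X3.add ((X1.mul X2).cmul 3)).sub ((X1.mul X1.sq).cmul 3)).sub
    ((V1.sq.mul X1).cmul (2/3))).add
    (((((S.v0.comp Ph _ hPh cPh).mul X1).cmul 2).sub
      (((S.v0.comp Ps _ hPs cPs).mul V1).cmul (4/9))).mul (S.x0.cmul (-2)).exp)
  refine ⟨_, S.nx (S.d S.sx) (fun ξ t ht => S.x1.dt ht) hF (a := x) (b := x), ?_⟩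
  intro ξ t ht
  ring

lemma v2 (S : Sys T x v ρ) : ∃ q, HD T ρ (Ds ρ (Ds ρ v)) (Ds ρ (Ds ρ (Ds ρ v))) q ∧
   ∀ ξ t, 0 < t ∧ t < T → q ξ t = 
   Ds ρ (Ds ρ (Ds ρ (Ds ρ v))) ξ t
    + 3 * (Ds ρ (Ds ρ x) ξ t * Ds ρ (Ds ρ v) ξ t + Ds ρ x ξ t * Ds ρ (Ds ρ (Ds ρ v)) ξ t)
    - 3 * (Ds ρ x ξ t ^ 2 * Ds ρ (Ds ρ v) ξ t + 2 * Ds ρ x ξ t * Ds ρ (Ds ρ x) ξ t * Ds ρ v ξ t)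
      - 2 * (Ds ρ v ξ t ^ 2 * Ds ρ (Ds ρ v) ξ t)
     + (Ps2 (v ξ t) * Ds ρ v ξ t ^ 2 + Ps1 (v ξ t) * Ds ρ (Ds ρ v) ξ t - 2 * (Ps1 (v ξ t) * Ds ρ v ξ t * Ds ρ x ξ t
        + Ps (v ξ t) * Ds ρ (Ds ρ x) ξ t) 
        - 2 * Ds ρ x ξ t * (Ps1 (v ξ t) * Ds ρ v ξ t - 2 * (Ps (v ξ t) * Ds ρ x ξ t))) * rexp (-2 * x ξ t)
      - (3 * (Ds ρ (Ds ρ x) ξ t + Ds ρ x ξ t ^ 2) + 2/3 * Ds ρ v ξ t ^ 2) * Ds ρ (Ds ρ v) ξ t := by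
  have X1 := S.b (S.d S.sx)
  have V1 := S.b (S.d S.sv)
  have X2 := S.b (S.d (S.d S.sx))
  have V2 := S.b (S.d (S.d S.sv))
  have V3 := S.b (S.d (S.d (S.d S.sv)))
  have hF := (((V3.add ((X1.mul V2).cmul 3)).sub ((X1.sq.mul V1).cmul 3)).sub
    ((V1.sq.mul V1).cmul (2/3))).add
    ((((S.v0.comp Ps1 _ hPs1 cPs1).mul V1).sub
      (((S.v0.comp Ps _ hPs cPs).mul X1).cmul 2)).mul (S.x0.cmul (-2)).exp)
  refine ⟨_, S.nx (S.d S.sv) (fun ξ t ht => S.v1.dt ht) hF (a := x) (b := x), ?_⟩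
  intro ξ t ht
  ring

lemma smN (S : Sys T x v ρ) : Sm T (fun ξ t => rexp (2 * x ξ t)) := (S.x0.cmul 2).exp.sm
lemma smZ (S : Sys T x v ρ) : Sm T (ZZ ρ x) := S.smN.mul ((S.d S.sx).pow 2)
lemma smW (S : Sys T x v ρ) : Sm T (WW ρ x v) := S.smN.mul ((S.d S.sv).pow 2)
lemma smD (S : Sys T x v ρ) : Sm T (DD ρ x) :=
  S.smN.mul ((S.d (S.d S.sx)).add ((S.d S.sx).pow 2))
lemma perN (S : Sys T x v ρ) : Per (fun ξ t => rexp (2 * x ξ t)) := fun ξ t => by simp only [S.px ξ t]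
lemma p1 (S : Sys T x v ρ) {φ} (h : Per φ) : Per (Ds ρ φ) := Per.Ds S.pρ h
lemma perZ (S : Sys T x v ρ) : Per (ZZ ρ x) := fun ξ t => by
  simp only [ZZ, S.px ξ t, S.p1 S.px ξ t]
lemma perW (S : Sys T x v ρ) : Per (WW ρ x v) := fun ξ t => by
  simp only [WW, S.px ξ t, S.p1 S.pv ξ t]
lemma perD (S : Sys T x v ρ) : Per (DD ρ x) := fun ξ t => by
  simp only [DD, S.px ξ t, S.p1 S.px ξ t, S.p1 (S.p1 S.px) ξ t]

lemma EN (a : ℝ) : rexp (-2 * a) = (rexp (2*a))⁻¹ := by rw [← Real.exp_neg]; ring_nf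

lemma evN (S : Sys T x v ρ) {ξ t : ℝ} (ht : 0 < t ∧ t < T) :
    Ds ρ (fun ξ t => rexp (2 * x ξ t)) ξ t = 2 * Ds ρ x ξ t * rexp (2 * x ξ t) ∧ 
    pdt (fun ξ t => rexp (2 * x ξ t)) ξ t = Ds ρ (Ds ρ (fun ξ t => rexp (2 * x ξ t))) ξ t
     - Ds ρ x ξ t * Ds ρ (fun ξ t => rexp (2 * x ξ t)) ξ t + (4 * ZZ ρ x ξ t - 2 * Ph (v ξ t)) ∧
    pdt (fun ξ t => rexp (2 * x ξ t)) ξ t = 2 * DD ρ x ξ t + 4 * ZZ ρ x ξ t - 2 * Ph (v ξ t) := by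
  have h := (S.x0.cmul 2).exp
  have h1 := (S.x1.cmul 2).mul h
  rw [h.ds S.hp ht, h.dss h1 S.hp ht, h.dt ht]
  simp only [ZZ, DD]
  rw [EN]
  refine ⟨trivial, ?_, ?_⟩ <;> (field_simp; try ring)

lemma evZ (S : Sys T x v ρ) {ξ t : ℝ} (ht : 0 < t ∧ t < T) :
    Ds ρ (ZZ ρ x) ξ t = 2 * Ds ρ x ξ t * DD ρ x ξ t ∧ 
    pdt (ZZ ρ x) ξ t = Ds ρ (Ds ρ (ZZ ρ x)) ξ t
     - Ds ρ x ξ t * Ds ρ (ZZ ρ x) ξ t + rexp (-2 * x ξ t) * (- 2 * DD ρ x ξ t ^ 2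
      + 4 * ZZ ρ x ξ t * DD ρ x ξ t + 2 * Ph (v ξ t) * ZZ ρ x ξ t - 4 * ZZ ρ x ξ t ^ 2
       - 8/9 * Ps (v ξ t) * PP ρ x v ξ t - 4/3 * WW ρ x v ξ t * ZZ ρ x ξ t) := by
  have h : HD T ρ (ZZ ρ x) _ _ := (S.x0.cmul 2).exp.mul S.x1.sq
  obtain ⟨q, hq, _⟩ := S.x2
  have h1 := (((S.x1.cmul 2).mul (S.x0.cmul 2).exp).mul S.x1.sq).add
    ((S.x0.cmul 2).exp.mul ((S.x1.cmul 2).mul hq))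
  rw [h.ds S.hp ht, h.dss h1 S.hp ht, h.dt ht]
  simp only [ZZ, DD, WW, PP]
  rw [EN]
  refine ⟨by ring, ?_⟩
  field_simp; ring

lemma evW (S : Sys T x v ρ) {ξ t : ℝ} (ht : 0 < t ∧ t < T) :
    pdt (WW ρ x v) ξ t = Ds ρ (Ds ρ (WW ρ x v)) ξ t
     - Ds ρ x ξ t * Ds ρ (WW ρ x v) ξ t + rexp (-2 * x ξ t) * (- 2 * VV ρ x v ξ t ^ 2
      + WW ρ x v ξ t * (2 * Ps1 (v ξ t) - 2 * Ph (v ξ t) - 2 * ZZ ρ x ξ t)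
       - 4 * Ps (v ξ t) * PP ρ x v ξ t - 4/3 * WW ρ x v ξ t ^ 2) := by
  have h : HD T ρ (WW ρ x v) _ _ := (S.x0.cmul 2).exp.mul S.v1.sq
  obtain ⟨q, hq, _⟩ := S.v2
  have h1 := (((S.x1.cmul 2).mul (S.x0.cmul 2).exp).mul S.v1.sq).add
    ((S.x0.cmul 2).exp.mul ((S.v1.cmul 2).mul hq))
  rw [h.ds S.hp ht, h.dss h1 S.hp ht, h.dt ht]
  simp only [ZZ, VV, WW, PP]
  rw [EN]
  field_simp; ring

lemma evD (S : Sys T x v ρ) {ξ t : ℝ} (ht : 0 < t ∧ t < T) :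
    pdt (DD ρ x) ξ t = Ds ρ (Ds ρ (DD ρ x)) ξ t
     - Ds ρ x ξ t * Ds ρ (DD ρ x) ξ t + rexp (-2 * x ξ t) * (- 2 * DD ρ x ξ t ^ 2
      - 4 * ZZ ρ x ξ t * DD ρ x ξ t - 2 * (Ph (v ξ t) - 2 * ZZ ρ x ξ t) * ZZ ρ x ξ t
       + 8/9 * Ps (v ξ t) * PP ρ x v ξ t - 4/9 * Ps1 (v ξ t) * WW ρ x v ξ t
       - 4/9 * Ps (v ξ t) * VV ρ x v ξ t - 4/3 * PP ρ x v ξ t * VV ρ x v ξ t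
       - 4/3 * WW ρ x v ξ t * DD ρ x ξ t) := by
  obtain ⟨q, hq, hqe⟩ := S.x2
  have X3 := S.b (S.d (S.d (S.d S.sx)))
  have h : HD T ρ (DD ρ x) _ _ := (S.x0.cmul 2).exp.mul (hq.add S.x1.sq)
  have h1 := (((S.x1.cmul 2).mul (S.x0.cmul 2).exp).mul (hq.add S.x1.sq)).add
    ((S.x0.cmul 2).exp.mul (X3.add ((S.x1.cmul 2).mul hq)))
  rw [h.ds S.hp ht, h.dss h1 S.hp ht, h.dt ht, hqe ξ t ht]
  simp only [ZZ, DD, VV, WW, PP]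
  rw [EN]
  field_simp; ring

lemma PPsq (ρ x v : ℝ → ℝ → ℝ) (ξ t : ℝ) : PP ρ x v ξ t ^ 2 = ZZ ρ x ξ t * WW ρ x v ξ t := by
  simp only [PP, ZZ, WW]; ring
lemma Znn (ρ x : ℝ → ℝ → ℝ) (ξ t : ℝ) : 0 ≤ ZZ ρ x ξ t := by unfold ZZ; positivity
lemma Wnn (ρ x v : ℝ → ℝ → ℝ) (ξ t : ℝ) : 0 ≤ WW ρ x v ξ t := by unfold WW; positivity
end Sys
end

section
set_option linter.unusedVariables false

structure Bd (k c0 v : ℝ) : Prop where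
  ps : |Ps v| ≤ k * |v|
  psv : v * Ps v ≤ - c0 * v ^ 2
  ps1u : Ps1 v ≤ -8 + k * |v|
  ps1 : |Ps1 v| ≤ k
  ps2 : |Ps2 v| ≤ k
  phl : 2 - k * v ^ 2 ≤ Ph v
  ph : |Ph v| ≤ k

lemma Ph_le (v : ℝ) : Ph v ≤ 2 := by
  unfold Ph
  have : rexp (8*v/3) = rexp (2*v/3) ^ 4 := by rw [← Real.exp_nat_mul]; congr 1; push_cast; ring
  rw [this]
  nlinarith [sq_nonneg (rexp (2*v/3) ^ 2 - 1), sq_nonneg (rexp (2*v/3) - 1)]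

lemma mvt {F F' : ℝ → ℝ} (hF : ∀ x, HasDerivAt F (F' x) x) {k v : ℝ}
    (hk : ∀ y, |y| ≤ |v| → |F' y| ≤ k) : |F v - F 0| ≤ k * |v| := by
  have hc : Convex ℝ (Icc (-|v|) |v|) := convex_Icc _ _
  have := hc.norm_image_sub_le_of_norm_hasDerivWithin_le (f := F) (f' := F') (C := k)
    (x := 0) (y := v) (fun y _ => (hF y).hasDerivWithinAt)
    (fun y hy => by rw [Real.norm_eq_abs]; exact hk y (abs_le.2 hy))
    (by constructor <;> simp [abs_nonneg])
    (by constructor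
        · exact neg_abs_le v
        · exact le_abs_self v)
  simpa [Real.norm_eq_abs] using this

lemma exists_Bd (v0 : ℝ) (h0 : 0 ≤ v0) : ∃ k c0, 0 < k ∧ 0 < c0 ∧ ∀ v, |v| ≤ v0 → Bd k c0 v := by
  have hE : ∀ c v, 0 ≤ c → c ≤ 8 → |v| ≤ v0 → rexp (c*v/3) ≤ rexp (8*v0/3) := by
    intro c v hc hc8 hv
    apply Real.exp_le_exp.2
    have := le_abs_self v
    have h2 : c * v ≤ c * v0 := mul_le_mul_of_nonneg_left (this.trans hv) hc
    have h3 : c * v0 ≤ 8 * v0 := mul_le_mul_of_nonneg_right hc8 h0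
    linarith
  set B := rexp (8*v0/3) with hB
  have hBp : 0 < B := Real.exp_pos _
  have b1 : ∀ v, |v| ≤ v0 → |Ps1 v| ≤ 14 * B := by
    intro v hv
    have := hE 2 v (by norm_num) (by norm_num) hv
    have := hE 8 v (by norm_num) (by norm_num) hv
    have := Real.exp_pos (2*v/3); have := Real.exp_pos (8*v/3)
    unfold Ps1; rw [abs_le]; constructor <;> linarith
  have b2 : ∀ v, |v| ≤ v0 → |Ps2 v| ≤ 31 * B := by
    intro v hv
    have := hE 2 v (by norm_num) (by norm_num) hv
    have := hE 8 v (by norm_num) (by norm_num) hv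
    have := Real.exp_pos (2*v/3); have := Real.exp_pos (8*v/3)
    unfold Ps2; rw [abs_le]; constructor <;> linarith
  have b3 : ∀ v, |v| ≤ v0 → |Ps v| ≤ 14 * B * |v| := by
    intro v hv
    have := mvt hPs (k := 14*B) (v := v) (fun y hy => b1 y (hy.trans hv))
    have e : Ps 0 = 0 := by simp [Ps]
    rwa [e, sub_zero] at this
  refine ⟨31 * B, 8 * rexp (-2*v0) * rexp (-2*v0/3), by positivity, by positivity, ?_⟩
  intro v hv
  have hBv : 0 ≤ B * |v| := by positivity
  refine ⟨by linarith [b3 v hv], ?_, ?_, by linarith [b1 v hv], b2 v hv, ?_, ?_⟩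
  · have e : Ps v = -(4 * rexp (2*v/3) * (rexp (2*v) - 1)) := by
      unfold Ps
      rw [show 8*v/3 = 2*v/3 + 2*v by ring, Real.exp_add]; ring
    have h1 : 2 * rexp (-2*v0) * v^2 ≤ v * (rexp (2*v) - 1) := by
      rcases le_total 0 v with hv1 | hv1
      · have h2 : rexp (-2*v0) ≤ 1 := Real.exp_le_one_iff.2 (by linarith)
        have h3 := Real.add_one_le_exp (2*v)
        have h4 : v^2 * rexp (-2*v0) ≤ v^2 * 1 := mul_le_mul_of_nonneg_left h2 (sq_nonneg v)
        have h5 : v * (2*v) ≤ v * (rexp (2*v) - 1) := mul_le_mul_of_nonneg_left (by linarith) hv1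
        nlinarith
      · have h3 := Real.add_one_le_exp (-(2*v))
        have h2 : rexp (2*v) * rexp (-(2*v)) = 1 := by rw [← Real.exp_add]; simp
        have h6 : rexp (2*v) * (-(2*v)) ≤ 1 - rexp (2*v) := by
          have := mul_le_mul_of_nonneg_left h3 (Real.exp_pos (2*v)).le
          rw [h2] at this; linarith
        have h7 : rexp (-2*v0) ≤ rexp (2*v) := Real.exp_le_exp.2 (by
          have := (abs_le.1 hv).1; linarith)
        have h8 := mul_le_mul_of_nonneg_left h7 (sq_nonneg v)
        have h9 := mul_le_mul_of_nonneg_left h6 (neg_nonneg.2 hv1)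
        nlinarith
    have h2 : rexp (-2*v0/3) ≤ rexp (2*v/3) := Real.exp_le_exp.2 (by
          have := (abs_le.1 hv).1; linarith)
    rw [e]
    have h10 : 0 ≤ 2 * rexp (-2*v0) * v^2 := by positivity
    have := mul_le_mul h2 h1 h10 (Real.exp_pos _).le
    nlinarith
  · have := mvt hPs1 (k := 31*B) (v := v) (fun y hy => b2 y (hy.trans hv))
    have e : Ps1 0 = -8 := by simp [Ps1]; norm_num
    rw [e] at this
    linarith [(abs_le.1 this).2]
  · have := mvt hPh (k := 31*B*|v|) (v := v) (fun y hy => by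
      simp only [abs_mul]
      have h1 := b3 y (hy.trans hv)
      have h2 : B * |y| ≤ B * |v| := mul_le_mul_of_nonneg_left hy hBp.le
      rw [abs_of_pos (by norm_num : (0:ℝ) < 4/9)]
      linarith)
    have e : Ph 0 = 2 := by simp [Ph]; norm_num
    rw [e, mul_assoc, ← sq, sq_abs] at this
    linarith [(abs_le.1 this).1]
  · have := hE 2 v (by norm_num) (by norm_num) hv
    have := hE 8 v (by norm_num) (by norm_num) hv
    have := Real.exp_pos (2*v/3); have := Real.exp_pos (8*v/3)
    unfold Ph; rw [abs_le]; constructor <;> linarith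

namespace Sys
variable {T : ℝ} {x v ρ : ℝ → ℝ → ℝ}

lemma step1 (S : Sys T x v ρ) {t0 : ℝ} (h0 : 0 < t0) (hT : t0 < T) :
    ∃ k c0 v0, 0 < k ∧ 0 < c0 ∧ 0 < v0 ∧ ∀ ξ t, t0 ≤ t → t < T → |v ξ t| ≤ v0 ∧ Bd k c0 (v ξ t) := by
  have hd := S.v0.sq
  have hper : Per (fun ξ t => v ξ t ^ 2) := fun ξ t => by simp only [S.pv ξ t]
  obtain ⟨C, hC, hCb⟩ := exists_bd hd.sm hper ⟨h0, hT⟩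
  have hmain := hd.max ((S.v0.cmul 2).mul S.v1) hper S.sρ S.hp h0 hCb (by
    intro ξ t ht htt e1 e2 e3
    have hvne : v ξ t ≠ 0 := by intro h; rw [h] at e1; simp at e1; linarith
    have hv1 : Ds ρ v ξ t = 0 := by
      rcases mul_eq_zero.1 e2 with h | h
      · exact absurd (by linarith) hvne
      · exact h
    obtain ⟨k, c0, hk, hc0, hb⟩ := exists_Bd |v ξ t| (abs_nonneg _)
    have := (hb _ le_rfl).psv
    have hE := Real.exp_pos (-2 * x ξ t)
    have hneg : v ξ t * Ps (v ξ t) < 0 := by nlinarith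
    rw [hv1] at e3 ⊢
    have := mul_neg_of_neg_of_pos hneg hE
    nlinarith)
  obtain ⟨k, c0, hk, hc0, hb⟩ := exists_Bd (√C) (Real.sqrt_nonneg _)
  refine ⟨k, c0, √C, hk, hc0, Real.sqrt_pos.2 hC, fun ξ t h1 h2 => ?_⟩
  have : |v ξ t| ≤ √C := Real.abs_le_sqrt (hmain ξ t h1 h2).le
  exact ⟨this, hb _ this⟩

lemma step2 (S : Sys T x v ρ) {t0 k c0 : ℝ} (h0 : 0 < t0) (hT : t0 < T)
    (hB : ∀ ξ t, t0 ≤ t → t < T → Bd k c0 (v ξ t)) :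
    ∃ X0, ∀ ξ t, t0 ≤ t → t < T → x ξ t ≤ X0 := by
  have hd := (S.b S.smN).addct (-(2*|k|+1))
  have hd1 := S.b (S.d S.smN)
  have hper : Per (fun ξ t => rexp (2 * x ξ t) + -(2*|k|+1) * t) := fun ξ t => by
    simp only [S.px ξ t]
  obtain ⟨C, hC, hCb⟩ := exists_bd hd.sm hper ⟨h0, hT⟩
  have hmain := hd.max hd1 hper S.sρ S.hp h0 hCb (by
    intro ξ t ht htt e1 e2 e3
    obtain ⟨f1, f2, f3⟩ := S.evN ht (ξ := ξ)
    have hN := Real.exp_pos (2 * x ξ t)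
    have hx1 : Ds ρ x ξ t = 0 := by
      rw [f1] at e2
      rcases mul_eq_zero.1 e2 with h | h
      · linarith
      · linarith
    have hz : ZZ ρ x ξ t = 0 := by simp [ZZ, hx1]
    simp only [f2, hx1, hz]
    have := (hB ξ t htt.le ht.2).ph
    have := neg_abs_le (Ph (v ξ t)); have := le_abs_self k
    linarith)
  refine ⟨Real.log (C + (2*|k|+1) * T) / 2, fun ξ t h1 h2 => ?_⟩
  have := hmain ξ t h1 h2
  have h3 : (2*|k|+1) * t ≤ (2*|k|+1) * T := mul_le_mul_of_nonneg_left h2.le (by positivity)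
  have h4 : rexp (2 * x ξ t) ≤ C + (2*|k|+1)*T := by linarith
  have := (Real.le_log_iff_exp_le (lt_of_lt_of_le (Real.exp_pos _) h4)).2 h4
  linarith

lemma step3 (S : Sys T x v ρ) {t0 k c0 v0 : ℝ} (h0 : 0 < t0) (hT : t0 < T) (hk : 0 < k)
    (hv0 : 0 < v0)
    (hB : ∀ ξ t, t0 ≤ t → t < T → |v ξ t| ≤ v0 ∧ Bd k c0 (v ξ t)) :
    ∃ z1, 0 < z1 ∧ ∀ ξ t, t0 ≤ t → t < T → ZZ ρ x ξ t ≤ z1 := by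
  have hd := S.b S.smZ
  have hd1 := S.b (S.d S.smZ)
  obtain ⟨C, hC, hCb⟩ := exists_bd hd.sm S.perZ ⟨h0, hT⟩
  set z1 := C + 2 + k * v0 with hz1
  have hkv : 0 < k * v0 := by positivity
  refine ⟨z1, by positivity, fun ξ t h1 h2 => le_of_lt ?_⟩
  refine hd.max hd1 S.perZ S.sρ S.hp h0 (A := z1) (fun ξ => by linarith [hCb ξ]) ?_ ξ t h1 h2
  intro ξ t ht htt e1 e2 e3
  obtain ⟨f1, f2⟩ := S.evZ ht (ξ := ξ)
  obtain ⟨g1, g2⟩ := hB ξ t htt.le ht.2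
  have hx1 : Ds ρ x ξ t ≠ 0 := by
    intro h
    simp [ZZ, h] at e1
    linarith
  have hD : DD ρ x ξ t = 0 := by
    rw [f1] at e2
    rcases mul_eq_zero.1 e2 with h | h
    · exact absurd (by linarith) hx1
    · exact h
  rw [f2, e2, hD]
  have hE := Real.exp_pos (-2 * x ξ t)
  have hP := PPsq ρ x v ξ t
  rw [e1] at hP ⊢
  have hPs : Ps (v ξ t) ^ 2 ≤ (k * v0)^2 := by
    rw [← sq_abs]
    exact pow_le_pow_left₀ (abs_nonneg _) (g2.ps.trans (mul_le_mul_of_nonneg_left g1 hk.le)) 2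
  have hPh := Ph_le (v ξ t)
  have key : - 2 * (0:ℝ) ^ 2
      + 4 * z1 * 0 + 2 * Ph (v ξ t) * z1 - 4 * z1 ^ 2
       - 8/9 * Ps (v ξ t) * PP ρ x v ξ t - 4/3 * WW ρ x v ξ t * z1 < 0 := by
    have q1 : Ph (v ξ t) * z1 ≤ 2 * z1 := mul_le_mul_of_nonneg_right hPh (by positivity)
    have q2 := sq_nonneg (PP ρ x v ξ t + Ps (v ξ t) / 3)
    have q3 : z1 ^ 2 = z1 * (C + 2 + k * v0) := by rw [sq]
    have q4 : z1 * (C + 2 + k * v0) ≥ 2 * z1 + (k*v0)^2 := by rw [hz1]; nlinarith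
    nlinarith
  nlinarith

lemma step4 (S : Sys T x v ρ) {t0 k c0 z1 : ℝ} (h0 : 0 < t0) (hT : t0 < T)
    (hc0 : 0 < c0) (hz : 0 < z1)
    (hB : ∀ ξ t, t0 ≤ t → t < T → Bd k c0 (v ξ t))
    (hZ : ∀ ξ t, t0 ≤ t → t < T → ZZ ρ x ξ t ≤ z1) :
    ∃ α c1, 0 < α ∧ α ≤ 1 ∧ 0 < c1 ∧
      ∀ ξ t, t0 ≤ t → t < T → |v ξ t| ≤ c1 * rexp (α * x ξ t) := by
  set α := min 1 (c0 / (z1 + 3)) with hα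
  have hα0 : 0 < α := lt_min one_pos (by positivity)
  have hα1 : α ≤ 1 := min_le_left _ _
  have hα2 : α * (z1 + 3) ≤ c0 := by
    have : α ≤ c0 / (z1 + 3) := min_le_right _ _
    rwa [le_div_iff₀ (by positivity)] at this
  have hd := S.v0.sq.mul (S.x0.cmul (-2*α)).exp
  have hd1 := (((S.v0.cmul 2).mul S.v1).mul (S.x0.cmul (-2*α)).exp).add
    (S.v0.sq.mul ((S.x1.cmul (-2*α)).mul (S.x0.cmul (-2*α)).exp))
  have hper : Per (fun ξ t => v ξ t ^ 2 * rexp (-2*α * x ξ t)) := fun ξ t => by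
    simp only [S.px ξ t, S.pv ξ t]
  obtain ⟨C, hC, hCb⟩ := exists_bd hd.sm hper ⟨h0, hT⟩
  have hmain := hd.max hd1 hper S.sρ S.hp h0 hCb (by
    intro ξ t ht htt e1 e2 e3
    have hvne : v ξ t ≠ 0 := by intro h; rw [h] at e1; simp at e1; linarith
    have he := Real.exp_pos (-2*α * x ξ t)
    have hE := Real.exp_pos (-2 * x ξ t)
    have b1 := hB ξ t htt.le ht.2
    have b2 := hZ ξ t htt.le ht.2
    have hP2 := Ph_le (v ξ t)
    set e := rexp (-2*α * x ξ t)
    set E := rexp (-2 * x ξ t) with hEdef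
    have hx1 : Ds ρ x ξ t ^ 2 = E * ZZ ρ x ξ t := by
      simp only [ZZ, hEdef]; rw [EN]; field_simp
    set X1 := Ds ρ x ξ t
    set V1 := Ds ρ v ξ t
    set X2 := Ds ρ (Ds ρ x) ξ t
    set V2 := Ds ρ (Ds ρ v) ξ t
    set V := v ξ t
    have hV1 : V1 = α * X1 * V := by
      have : (2 * V * e) * (V1 - α * X1 * V) = 0 := by linear_combination e2
      rcases mul_eq_zero.1 this with h | h
      · exact absurd h (by positivity)
      · linarith
    rw [hV1] at e3 ⊢
    have e4 : e * (2 * V * V2 - 2 * α^2 * V^2 * X1^2 - 2 * α * X2 * V^2) ≤ 0 := by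
      linarith
    have e5 : 2 * V * V2 - 2 * α^2 * V^2 * X1^2 - 2 * α * X2 * V^2 ≤ 0 := by
      by_contra hcon
      push Not at hcon
      linarith [mul_pos he hcon]
    have hgoal : 2 * V * V2 - 2*α*X2*V^2 + E * (2 * (V * Ps V) + 2 * α * Ph V * V^2) < 0 := by
      have hV2p : 0 < V^2 := by positivity
      have q : 2 * V * V2 - 2*α*X2*V^2 ≤ 2 * α^2 * V^2 * (E * ZZ ρ x ξ t) := by
        rw [← hx1]; linarith
      have q2 : 2 * α^2 * V^2 * ZZ ρ x ξ t + (2 * (V * Ps V) + 2 * α * Ph V * V^2) < 0 := by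
        have r1 : V^2 * (α^2 * ZZ ρ x ξ t) ≤ V^2 * (α * z1) := by
          apply mul_le_mul_of_nonneg_left _ hV2p.le
          have : α^2 * ZZ ρ x ξ t ≤ α^2 * z1 := mul_le_mul_of_nonneg_left b2 (sq_nonneg _)
          have : α^2 * z1 ≤ α * z1 := mul_le_mul_of_nonneg_right (by nlinarith) hz.le
          linarith
        have r2 : (α * V^2) * Ph V ≤ (α * V^2) * 2 := mul_le_mul_of_nonneg_left hP2 (by positivity)
        have r3 := b1.psv
        have r4 : V^2 * (α * (z1+3)) ≤ V^2 * c0 := mul_le_mul_of_nonneg_left hα2 hV2p.le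
        have r5 : 0 < V^2 * α := by positivity
        nlinarith
      have := mul_neg_of_pos_of_neg hE q2
      nlinarith
    have := mul_neg_of_pos_of_neg he hgoal
    nlinarith)
  refine ⟨α, √C, hα0, hα1, Real.sqrt_pos.2 hC, fun ξ t h1 h2 => ?_⟩
  have h3 := hmain ξ t h1 h2
  have h4 : rexp (-2*α * x ξ t) = (rexp (α * x ξ t) ^ 2)⁻¹ := by
    rw [← Real.exp_nat_mul, ← Real.exp_neg]; congr 1; push_cast; ring
  have hep := Real.exp_pos (α * x ξ t)
  rw [h4, ← div_eq_mul_inv, div_lt_iff₀ (by positivity)] at h3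
  apply abs_le_of_sq_le_sq _ (by positivity)
  rw [mul_pow, Real.sq_sqrt hC.le]; exact h3.le

lemma alg5 {Z α Phi Psi P W m : ℝ} (hα : 0 < α) (hα1 : α ≤ 1) (hZg : 0 < Z - 1) (hP2 : Phi ≤ 2)
    (hP : P ^ 2 = Z * W) (hPs : Psi ^ 2 ≤ m) (r4 : m ≤ Z - 1) :
    (Z-1) * (α^2 * Z - 4 * α * Z + α * Phi) + (- 2 * (α * (Z-1)/2) ^ 2 + 4 * Z * (α * (Z-1)/2)
      + 2 * Phi * Z - 4 * Z ^ 2 - 8/9 * Psi * P - 4/3 * W * Z) < 0 := by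
  have r1 := sq_nonneg (P + Psi/3)
  have r2 : Phi * Z ≤ 2 * Z := mul_le_mul_of_nonneg_right hP2 (by linarith)
  have r3 : (α * (Z-1)) * Phi ≤ (α * (Z-1)) * (2 * Z) :=
    mul_le_mul_of_nonneg_left (by linarith) (by positivity)
  have r5 : 3 * (Z - 1) ≤ (4 - α^2) * (Z * (Z-1)) := by
    have : (1:ℝ) * (Z-1) ≤ Z * (Z-1) := mul_le_mul_of_nonneg_right (by linarith) hZg.le
    have h4 : 3 ≤ 4 - α^2 := by nlinarith
    have := mul_le_mul h4 this (by linarith) (by linarith)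
    linarith
  have r6 := sq_nonneg (α * (Z-1)/2)
  linarith

set_option maxHeartbeats 1000000 in
lemma step5 (S : Sys T x v ρ) {t0 k c0 α c1 X0 : ℝ} (h0 : 0 < t0) (hT : t0 < T)
    (hk : 0 < k) (hα : 0 < α) (hα1 : α ≤ 1) (hc1 : 0 < c1)
    (hB : ∀ ξ t, t0 ≤ t → t < T → Bd k c0 (v ξ t))
    (hX : ∀ ξ t, t0 ≤ t → t < T → x ξ t ≤ X0)
    (hV : ∀ ξ t, t0 ≤ t → t < T → |v ξ t| ≤ c1 * rexp (α * x ξ t)) :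
    ∃ c5, 0 < c5 ∧ ∀ ξ t, t0 ≤ t → t < T → ZZ ρ x ξ t ≤ 1 + c5 * rexp (α * x ξ t) := by
  have hZ0 := S.b S.smZ
  have hZ1 := S.b (S.d S.smZ)
  have hd := (hZ0.addc (-1)).mul (S.x0.cmul (-α)).exp
  have hd1 := (hZ1.mul (S.x0.cmul (-α)).exp).add
    ((hZ0.addc (-1)).mul ((S.x1.cmul (-α)).mul (S.x0.cmul (-α)).exp))
  have hper : Per (fun ξ t => (ZZ ρ x ξ t + -1) * rexp (-α * x ξ t)) := fun ξ t => by
    simp only [S.px ξ t, S.perZ ξ t]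
  obtain ⟨C, hC, hCb⟩ := exists_bd hd.sm hper ⟨h0, hT⟩
  set M0 := (k * c1)^2 * rexp (α * X0) with hM0
  have hM0p : 0 < M0 := by positivity
  set A := C + M0 with hA
  have hAp : 0 < A := by positivity
  have hmain := hd.max hd1 hper S.sρ S.hp h0 (A := A) (fun ξ => by linarith [hCb ξ]) (by
    intro ξ t ht htt e1 e2 e3
    have he := Real.exp_pos (-α * x ξ t)
    have hE := Real.exp_pos (-2 * x ξ t)
    have b1 := hB ξ t htt.le ht.2
    have b2 := hV ξ t htt.le ht.2
    have hP2 := Ph_le (v ξ t)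
    obtain ⟨f1, f2⟩ := S.evZ ht (ξ := ξ)
    have hth : A * rexp (α * x ξ t) = ZZ ρ x ξ t - 1 := by
      rw [← e1, mul_assoc, ← Real.exp_add]; simp; ring
    have hthm : rexp (α * x ξ t) ≤ rexp (α * X0) :=
      Real.exp_le_exp.2 (mul_le_mul_of_nonneg_left (hX ξ t htt.le ht.2) hα.le)
    have hthp := Real.exp_pos (α * x ξ t)
    have hPs : Ps (v ξ t) ^ 2 ≤ (k * c1)^2 * (rexp (α * X0) * rexp (α * x ξ t)) := by
      rw [← sq_abs]
      have := pow_le_pow_left₀ (abs_nonneg _) (b1.ps.trans (mul_le_mul_of_nonneg_left b2 hk.le)) 2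
      refine this.trans ?_
      rw [show (k * (c1 * rexp (α * x ξ t)))^2 = (k*c1)^2 * (rexp (α * x ξ t) * rexp (α * x ξ t)) by ring]
      gcongr
    have hP := PPsq ρ x v ξ t
    have hW := Wnn ρ x v ξ t
    set e := rexp (-α * x ξ t)
    set E := rexp (-2 * x ξ t) with hEdef
    set θ := rexp (α * x ξ t)
    have hx1 : Ds ρ x ξ t ^ 2 = E * ZZ ρ x ξ t := by
      simp only [ZZ, hEdef]; rw [EN]; field_simp
    have hx1e : Ds ρ x ξ t = 0 → ZZ ρ x ξ t = 0 := fun h => by simp [ZZ, h]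
    rw [f1] at e2
    rw [f1] at e3
    rw [f2, f1]
    set X1 := Ds ρ x ξ t
    set X2 := Ds ρ (Ds ρ x) ξ t
    set Z := ZZ ρ x ξ t
    set D := DD ρ x ξ t
    set Z2 := Ds ρ (Ds ρ (ZZ ρ x)) ξ t
    set P := PP ρ x v ξ t
    set W := WW ρ x v ξ t
    set Psi := Ps (v ξ t)
    set Phi := Ph (v ξ t)
    have hZg : 0 < Z - 1 := by rw [← hth]; positivity
    have hX1 : X1 ≠ 0 := fun h => by have := hx1e h; linarith
    have hD : D = α * (Z - 1) / 2 := by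
      have : (X1 * e) * (2 * D - α * (Z - 1)) = 0 := by linear_combination e2
      rcases mul_eq_zero.1 this with h | h
      · exact absurd h (by positivity)
      · linarith
    have e4 : e * (Z2 - (Z-1) * (α * X2 + α^2 * X1^2)) ≤ 0 := by
      rw [hD] at e3; linarith
    have e5 : Z2 - (Z-1) * (α * X2 + α^2 * X1^2) ≤ 0 := by
      by_contra hcon
      push Not at hcon
      linarith [mul_pos he hcon]
    have hgoal : Z2 - α * X1^2 * (Z-1) - α * (Z-1) * (X2 + 3 * X1^2 - Phi * E) +
       E * (- 2 * D ^ 2 + 4 * Z * D + 2 * Phi * Z - 4 * Z ^ 2 - 8/9 * Psi * P - 4/3 * W * Z) < 0 := by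
      have q1 : Z2 - α * X1^2 * (Z-1) - α * (Z-1) * (X2 + 3 * X1^2 - Phi * E) ≤
        E * ((Z-1) * (α^2 * Z - 4 * α * Z + α * Phi)) := by
        have : (Z-1) * ((α^2 - 4 * α) * X1^2) = (Z-1) * ((α^2-4*α) * (E * Z)) := by rw [hx1]
        linarith
      have q2 : (Z-1) * (α^2 * Z - 4 * α * Z + α * Phi) + (- 2 * D ^ 2 + 4 * Z * D + 2 * Phi * Z - 4 * Z ^ 2 - 8/9 * Psi * P - 4/3 * W * Z) < 0 := by
        rw [hD]
        have r4 : (k*c1)^2 * (rexp (α*X0) * θ) ≤ Z - 1 := by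
          rw [← hth, hA]
          have : (k*c1)^2 * (rexp (α*X0) * θ) = M0 * θ := by rw [hM0]; ring
          rw [this]
          have : 0 < C * θ := by positivity
          linarith
        exact alg5 hα hα1 hZg hP2 hP hPs r4
      have := mul_neg_of_pos_of_neg hE q2
      linarith
    have := mul_neg_of_pos_of_neg he hgoal
    rw [hD] at this ⊢
    linarith)
  refine ⟨A, hAp, fun ξ t h1 h2 => ?_⟩
  have h3 := hmain ξ t h1 h2
  have hep := Real.exp_pos (α * x ξ t)
  have h4 : rexp (-α * x ξ t) = (rexp (α * x ξ t))⁻¹ := by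
    rw [← Real.exp_neg]; congr 1; ring
  rw [h4, ← div_eq_mul_inv, div_lt_iff₀ hep] at h3
  linarith
end Sys
end

section
set_option linter.unusedVariables false

lemma alg6 {Z D W V P Phi Psi Psi1 θ a b c k z1 c5 lam : ℝ} (hZ0 : 0 ≤ Z) (hZ1 : Z ≤ z1)
    (hZ5 : Z ≤ 1 + c5 * θ) (hθ : 0 < θ) (ha : 0 < a) (hb : 0 < b) (hc5 : 0 < c5) (hk : 0 < k)
    (hPl : 2 - a * θ ≤ Phi) (hPs : Psi ^ 2 ≤ b * θ) (hPs1 : Psi1 ≤ -8 + c * θ)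
    (hPs1a : |Psi1| ≤ k) (hP : P ^ 2 = Z * W) (hW : 0 ≤ W) (hl : 1 ≤ lam) (hl2 : 2 * z1 + k ≤ lam) :
    (- 2 * D ^ 2 - 4 * Z * D - 2 * (Phi - 2 * Z) * Z + 8/9 * Psi * P - 4/9 * Psi1 * W
       - 4/9 * Psi * V - 4/3 * P * V - 4/3 * W * D)
     + lam * (- 2 * V ^ 2 + W * (2 * Psi1 - 2 * Phi - 2 * Z) - 4 * Psi * P - 4/3 * W ^ 2) ≤
     - 2 * D ^ 2 - 16 * (lam * W) - 4/3 * W * (D + lam * W) + (2*c + 2*a + 3*c5) * θ * (lam * W)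
      + (2 * z1 * (a + 2 * c5) + 2 * b + 4 * lam * b) * θ - 4 * Z * (D + lam * W) := by
  have hz1 : 0 ≤ z1 := hZ0.trans hZ1
  have p1 : - 2 * (Phi - 2 * Z) * Z ≤ 2 * z1 * (a + 2 * c5) * θ := by
    have h1 : - 2 * (Phi - 2 * Z) ≤ 2 * ((a + 2 * c5) * θ) := by linarith
    have h2 := mul_le_mul_of_nonneg_right h1 hZ0
    have h3 : 2 * ((a + 2 * c5) * θ) * Z ≤ 2 * ((a + 2 * c5) * θ) * z1 :=
      mul_le_mul_of_nonneg_left hZ1 (by positivity)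
    linarith
  have hZW : Z * W ≤ z1 * W := mul_le_mul_of_nonneg_right hZ1 hW
  have p2 : 8/9 * Psi * P ≤ Psi ^ 2 + z1 * W := by
    have := sq_nonneg (Psi - P)
    have := sq_nonneg Psi; have := sq_nonneg P
    linarith
  have p3 : - 4/9 * Psi1 * W ≤ k * W := by
    have h1 : - 4/9 * Psi1 ≤ k := by have := neg_abs_le Psi1; linarith
    exact mul_le_mul_of_nonneg_right h1 hW
  have p4 : - 4/9 * Psi * V - 4/3 * P * V ≤ 2 * V^2 + Psi ^ 2 + z1 * W := by
    have := sq_nonneg (V + 2/9*Psi); have := sq_nonneg (V + 2/3*P)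
    have := sq_nonneg Psi; have := sq_nonneg P
    linarith
  have p5 : lam * (-4 * Psi * P) ≤ lam * (4 * (b * θ) + Z * W) := by
    apply mul_le_mul_of_nonneg_left _ (by linarith)
    have := sq_nonneg (2 * Psi + P)
    linarith
  have hlW : 0 ≤ lam * W := mul_nonneg (by linarith) hW
  have p6 : (lam * W) * (2 * Psi1 - 2 * Phi + 3 * Z) ≤
      (lam * W) * (-17 + (2*c+2*a+3*c5) * θ) := by
    apply mul_le_mul_of_nonneg_left _ hlW
    linarith
  have p7 : V^2 * 1 ≤ V^2 * lam := mul_le_mul_of_nonneg_left hl (sq_nonneg V)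
  have p8 : (2 * z1 + k) * W ≤ lam * W := mul_le_mul_of_nonneg_right hl2 hW
  linarith

lemma alg6b {Re Q D W lam θ l A B7 C1 C2 X : ℝ} (hl : 1 ≤ lam) (hl4 : 4 ≤ l) (hθ : 0 < θ)
    (hQ : Q * l = A) (hQd : Q = D + lam * W) (hθl : θ * l ^ 2 ≤ B7) (hC1 : 0 ≤ C1) (hC2 : 0 ≤ C2)
    (hW : 0 ≤ W) (hX : 0 ≤ X)
    (hA1 : 10 ≤ A) (hA2 : C1 * lam * B7 ≤ A) (hA3 : C2 * B7 < A)
    (hRe : Re ≤ - 2 * D ^ 2 - 16 * (lam * W) - 4/3 * W * (D + lam * W) + C1 * θ * (lam * W) + C2 * θ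
        - 4 * X * (D + lam * W)) : l * Re + 4 * Q < 0 := by
  have hQp : 0 < Q := by
    by_contra h
    push Not at h
    have := mul_nonpos_of_nonpos_of_nonneg h (by linarith : (0:ℝ) ≤ l)
    linarith
  rw [← hQd] at hRe
  have h1 : C1 * lam * θ ≤ Q := by
    have e1 : (C1 * lam * θ) * l ≤ Q * l := by
      rw [hQ]
      have : θ * l ≤ θ * l ^ 2 := mul_le_mul_of_nonneg_left (by nlinarith) hθ.le
      have : (C1 * lam) * (θ * l) ≤ (C1 * lam) * B7 :=
        mul_le_mul_of_nonneg_left (this.trans hθl) (by positivity)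
      linarith
    exact le_of_mul_le_mul_right e1 (by linarith)
  have h2 : C1 * lam * θ * W ≤ Q * W := mul_le_mul_of_nonneg_right h1 hW
  have h2' : 0 ≤ Q * W := by positivity
  have h3 : 0 ≤ X * Q := by positivity
  have hRe2 : Re ≤ -2 * D^2 - 16 * (lam * W) + C2 * θ := by linarith
  have hθl1 : θ * l ≤ B7 := by
    have : θ * l ≤ θ * l ^ 2 := mul_le_mul_of_nonneg_left (by nlinarith) hθ.le
    linarith
  have hl0 : 0 < l := by linarith
  rcases le_total (Q/2) D with h | h
  · have hD : Q^2/4 ≤ D^2 := by nlinarith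
    have hlw : 0 ≤ lam * W := by positivity
    have e1 : l * Re ≤ l * (-(Q^2/2) + C2 * θ) := mul_le_mul_of_nonneg_left (by linarith) hl0.le
    have e2 : l * (l * Re + 4 * Q) < 0 := by
      have e3 : l * (l * Re + 4 * Q) ≤ l * (l * (-(Q^2/2) + C2 * θ) + 4 * Q) :=
        mul_le_mul_of_nonneg_left (by linarith) hl0.le
      have e4 : l * (l * (-(Q^2/2) + C2 * θ) + 4 * Q) = -(A^2/2) + C2 * (θ * l^2) + 4 * A := by
        rw [← hQ]; ring
      have e5 : C2 * (θ * l^2) ≤ C2 * B7 := mul_le_mul_of_nonneg_left hθl hC2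
      nlinarith
    by_contra hc
    push Not at hc
    have := mul_nonneg hl0.le hc
    linarith
  · have h5 : Q/2 ≤ lam * W := by linarith
    have hD : 0 ≤ D^2 := sq_nonneg D
    have e1 : l * Re ≤ l * (-8 * Q + C2 * θ) := mul_le_mul_of_nonneg_left (by linarith) hl0.le
    have e2 : C2 * (θ * l) ≤ C2 * B7 := mul_le_mul_of_nonneg_left hθl1 hC2
    have e3 : 4 * Q ≤ l * Q := mul_le_mul_of_nonneg_right hl4 hQp.le
    linarith

namespace Sys
variable {T : ℝ} {x v ρ : ℝ → ℝ → ℝ}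

set_option maxHeartbeats 1000000 in
lemma step6 (S : Sys T x v ρ) {t0 k c0 α c1 X0 z1 c5 : ℝ} (h0 : 0 < t0) (hT : t0 < T)
    (hk : 0 < k) (hα : 0 < α) (hα1 : α ≤ 1) (hc1 : 0 < c1) (hz1 : 0 < z1) (hc5 : 0 < c5)
    (hB : ∀ ξ t, t0 ≤ t → t < T → Bd k c0 (v ξ t))
    (hX : ∀ ξ t, t0 ≤ t → t < T → x ξ t ≤ X0)
    (hZ : ∀ ξ t, t0 ≤ t → t < T → ZZ ρ x ξ t ≤ z1)
    (hV : ∀ ξ t, t0 ≤ t → t < T → |v ξ t| ≤ c1 * rexp (α * x ξ t))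
    (hZ5 : ∀ ξ t, t0 ≤ t → t < T → ZZ ρ x ξ t ≤ 1 + c5 * rexp (α * x ξ t)) :
    ∃ lam K A, 1 ≤ lam ∧ 0 < A ∧ ∀ ξ t, t0 ≤ t → t < T → 4 ≤ K - 2 * x ξ t ∧
      DD ρ x ξ t + lam * WW ρ x v ξ t ≤ A / (K - 2 * x ξ t) := by
  set lam := 2 * z1 + k + 1 with hlam
  set K := 2 * X0 + 4 with hK
  set m := rexp (α * X0) with hm
  have hmp : 0 < m := Real.exp_pos _
  set a := k * c1^2 * m with ha
  set b := (k * c1)^2 * m with hb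
  set c := k * c1 with hc
  have hl4 : ∀ ξ t, t0 ≤ t → t < T → 4 ≤ K + (-2) * x ξ t := fun ξ t h1 h2 => by
    have := hX ξ t h1 h2; linarith
  set C1 := 2*c + 2*a + 3*c5 with hC1
  set C2 := 2 * z1 * (a + 2 * c5) + 2 * b + 4 * lam * b with hC2
  set B7 := rexp (α * K / 2) * (8 / α^2) with hB7
  have hθl : ∀ ξ t, t0 ≤ t → t < T → rexp (α * x ξ t) * (K + (-2) * x ξ t)^2 ≤ B7 := by
    intro ξ t h1 h2
    set l := K + (-2) * x ξ t with hl
    have hl4' := hl4 ξ t h1 h2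
    have e1 : rexp (α * x ξ t) = rexp (α * K/2) * (rexp (α * l/2))⁻¹ := by
      rw [← Real.exp_neg, ← Real.exp_add]; congr 1; rw [hl]; ring
    rw [e1, hB7, mul_assoc]
    apply mul_le_mul_of_nonneg_left _ (Real.exp_pos _).le
    have hpos : 0 ≤ α * l / 2 := by
      have : 0 ≤ l := by linarith
      positivity
    have := Real.quadratic_le_exp_of_nonneg hpos
    rw [inv_mul_le_iff₀ (Real.exp_pos _), mul_div_assoc', le_div_iff₀ (by positivity)]
    nlinarith
  have hQs : Sm T (fun ξ t => DD ρ x ξ t + lam * WW ρ x v ξ t) := S.smD.add ((Sm.const lam).mul S.smW)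
  have hD0 := S.b S.smD
  have hW0 := S.b S.smW
  have hD1 := S.b (S.d S.smD)
  have hW1 := S.b (S.d S.smW)
  have hQ := hD0.add (hW0.cmul lam)
  have hQ1 := hD1.add (hW1.cmul lam)
  have hL := (S.x0.cmul (-2)).addc K
  have hL1 := S.x1.cmul (-2)
  have hd := hQ.mul hL
  have hd1 := (hQ1.mul hL).add (hQ.mul hL1)
  have hper : Per (fun ξ t => (DD ρ x ξ t + lam * WW ρ x v ξ t) * (-2 * x ξ t + K)) := fun ξ t => by
    simp only [S.px ξ t, S.perD ξ t, S.perW ξ t]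
  obtain ⟨C, hC, hCb⟩ := exists_bd hd.sm hper ⟨h0, hT⟩
  have hB7p : 0 < B7 := by positivity
  have hlamp : 1 ≤ lam := by linarith
  have hlam0 : 0 < lam := by linarith
  have hap : 0 < a := by positivity
  have hbp : 0 < b := by positivity
  have hcp : 0 < c := by positivity
  have hC1p : 0 < C1 := by positivity
  have hC2p : 0 < C2 := by positivity
  set A := C + 10 + C1 * lam * B7 + C2 * B7 with hA
  have hA1 : 0 < C1 * lam * B7 := by positivity
  have hA2 : 0 < C2 * B7 := by positivity
  have hmain := hd.max hd1 hper S.sρ S.hp h0 (A := A) (fun ξ => by linarith [hCb ξ]) (by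
    intro ξ t ht htt e1 e2 e3
    have hE := Real.exp_pos (-2 * x ξ t)
    have b1 := hB ξ t htt.le ht.2
    have b2 := hV ξ t htt.le ht.2
    have b3 := hZ ξ t htt.le ht.2
    have b4 := hZ5 ξ t htt.le ht.2
    have b5 := hl4 ξ t htt.le ht.2
    have b6 := hθl ξ t htt.le ht.2
    have hP2 := Ph_le (v ξ t)
    have f2 := S.evD ht (ξ := ξ)
    have f3 := S.evW ht (ξ := ξ)
    have hθp := Real.exp_pos (α * x ξ t)
    have hθm : rexp (α * x ξ t) ≤ m :=
      Real.exp_le_exp.2 (mul_le_mul_of_nonneg_left (hX ξ t htt.le ht.2) hα.le)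
    have hv2 : v ξ t ^ 2 ≤ c1^2 * (m * rexp (α * x ξ t)) := by
      rw [← sq_abs]
      refine (pow_le_pow_left₀ (abs_nonneg _) b2 2).trans ?_
      rw [show (c1 * rexp (α * x ξ t))^2 = c1^2 * (rexp (α * x ξ t) * rexp (α * x ξ t)) by ring]
      gcongr
    have hPs : Ps (v ξ t) ^ 2 ≤ b * rexp (α * x ξ t) := by
      rw [← sq_abs]
      refine (pow_le_pow_left₀ (abs_nonneg _) b1.ps 2).trans ?_
      rw [mul_pow, sq_abs, hb]
      have := mul_le_mul_of_nonneg_left hv2 (sq_nonneg k)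
      linarith
    have hPl : 2 - a * rexp (α * x ξ t) ≤ Ph (v ξ t) := by
      have := mul_le_mul_of_nonneg_left hv2 hk.le
      have := b1.phl
      rw [ha]; linarith
    have hPs1 : Ps1 (v ξ t) ≤ -8 + c * rexp (α * x ξ t) := by
      have := mul_le_mul_of_nonneg_left b2 hk.le
      have := b1.ps1u
      rw [hc]; linarith
    have hPPs := PPsq ρ x v ξ t
    have hWn := Wnn ρ x v ξ t
    have hZn := Znn ρ x ξ t
    have hRe := alg6 (D := DD ρ x ξ t) (V := VV ρ x v ξ t) hZn b3 b4 hθp hap hbp hc5 hk hPl hPs hPs1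
      b1.ps1 hPPs hWn hlamp (show 2 * z1 + k ≤ lam by linarith)
    have hx1 : Ds ρ x ξ t ^ 2 = rexp (-2 * x ξ t) * ZZ ρ x ξ t := by
      simp only [ZZ]; rw [EN]; field_simp
    rw [f2, f3]
    set E := rexp (-2 * x ξ t) with hEdef
    set θ := rexp (α * x ξ t)
    set X1 := Ds ρ x ξ t
    set X2 := Ds ρ (Ds ρ x) ξ t
    set Z := ZZ ρ x ξ t
    set D := DD ρ x ξ t
    set D1 := Ds ρ (DD ρ x) ξ t
    set D2 := Ds ρ (Ds ρ (DD ρ x)) ξ t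
    set W1 := Ds ρ (WW ρ x v) ξ t
    set W2 := Ds ρ (Ds ρ (WW ρ x v)) ξ t
    set P := PP ρ x v ξ t
    set W := WW ρ x v ξ t
    set V := VV ρ x v ξ t
    set Psi := Ps (v ξ t)
    set Psi1 := Ps1 (v ξ t)
    set Phi := Ph (v ξ t)
    set RD := (- 2 * D ^ 2 - 4 * Z * D - 2 * (Phi - 2 * Z) * Z + 8/9 * Psi * P - 4/9 * Psi1 * W
       - 4/9 * Psi * V - 4/3 * P * V - 4/3 * W * D)
    set RW := (- 2 * V ^ 2 + W * (2 * Psi1 - 2 * Phi - 2 * Z) - 4 * Psi * P - 4/3 * W ^ 2)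
    set l := K + (-2) * x ξ t with hl
    rw [show -2 * x ξ t + K = l by rw [hl]; ring] at e1 e2 e3 ⊢
    clear_value E θ X1 X2 Z D D1 D2 W1 W2 P W V Psi Psi1 Phi l RD RW C1 C2 A B7
    rw [← hC1, ← hC2] at hRe
    have hneg := alg6b (Q := D + lam * W) hlamp b5 hθp e1 rfl b6 hC1p.le hC2p.le hWn hZn
      (by linarith) (by linarith) (by linarith) hRe
    have hl0 : 0 < l := by linarith
    set Q := D + lam * W with hQdef
    set Q1' := D1 + lam * W1 with hQ1def
    have hQ1e : Q1' * l = 2 * X1 * Q := by linarith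
    have hQ0 : 0 < Q := by
      by_contra h
      push Not at h
      have := mul_nonpos_of_nonpos_of_nonneg h hl0.le
      linarith
    have hX1Q1 : X1 * Q1' * l = 2 * E * Z * Q := by
      have : X1 * Q1' * l = 2 * X1^2 * Q := by linear_combination X1 * hQ1e
      rw [this, hx1]; ring
    have h8 : 4 * (X1 * Q1') ≤ 2 * (E * Z * Q) := by
      have hnn : 0 ≤ X1 * Q1' := by
        by_contra h
        push Not at h
        have h9 := mul_neg_of_neg_of_pos h hl0
        have : 0 ≤ 2 * E * Z * Q := by positivity
        linarith
      have := mul_le_mul_of_nonneg_left b5 hnn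
      linarith
    have h9 : E * (l * (RD + lam * RW) + 4 * Q) < 0 := mul_neg_of_pos_of_neg hE hneg
    have h10 : (E * Q) * Phi ≤ (E * Q) * 2 := mul_le_mul_of_nonneg_left hP2 (by positivity)
    have h11 : 0 ≤ E * Z * Q := by positivity
    have h12 : Q * X1^2 = Q * (E * Z) := by rw [hx1]
    have h13 : (D2 + lam * W2) * l ≤ 4 * (X1 * Q1') + 2 * X2 * Q := by linarith
    have h14 : (D2 - X1 * D1 + E * RD + lam * (W2 - X1 * W1 + E * RW)) * l
       = (D2 + lam * W2) * l - X1 * Q1' * l + E * (l * (RD + lam * RW)) := by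
      rw [hQ1def]; ring
    rw [h14]
    linarith)
  refine ⟨lam, K, A, hlamp, by positivity, fun ξ t h1 h2 => ?_⟩
  have h3 := hmain ξ t h1 h2
  have h4 := hl4 ξ t h1 h2
  refine ⟨by linarith, ?_⟩
  rw [le_div_iff₀ (by linarith)]
  have : K - 2 * x ξ t = -2 * x ξ t + K := by ring
  rw [this]; exact h3.le

end Sys
end

section
set_option linter.unusedVariables false

lemma alg7 {Z D W P V Psi Psi1 Phi z1 k ps : ℝ} (hZ : 0 ≤ Z) (hZ1 : Z ≤ z1) (hW : 0 ≤ W)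
    (hP : P^2 = Z * W) (hPs : Psi^2 ≤ ps) (hP1 : |Psi1| ≤ k) (hPh : |Phi| ≤ k) (hPh2 : Phi ≤ 2)
    (hY : 0 ≤ Z - D + W) :
    (- 2 * D ^ 2 + 4 * Z * D + 2 * Phi * Z - 4 * Z ^ 2 - 8/9 * Psi * P - 4/3 * W * Z)
    - (- 2 * D ^ 2 - 4 * Z * D - 2 * (Phi - 2 * Z) * Z + 8/9 * Psi * P - 4/9 * Psi1 * W
       - 4/9 * Psi * V - 4/3 * P * V - 4/3 * W * D)
    + (- 2 * V ^ 2 + W * (2 * Psi1 - 2 * Phi - 2 * Z) - 4 * Psi * P - 4/3 * W ^ 2)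
    ≤ -(4/3) * W * (Z - D + W) + (12 * z1 + 5 * k) * W + 8 * z1 + 4 * ps := by
  have h1 := mul_nonneg hZ hY
  have h2 : Phi * Z ≤ 2 * Z := mul_le_mul_of_nonneg_right hPh2 hZ
  have h3 : Z * W ≤ z1 * W := mul_le_mul_of_nonneg_right hZ1 hW
  have h4 : Psi1 * W ≤ k * W := mul_le_mul_of_nonneg_right (abs_le.1 hP1).2 hW
  have h5 : -k * W ≤ Phi * W := mul_le_mul_of_nonneg_right (abs_le.1 hPh).1 hW
  have h6 := sq_nonneg (Psi + P)
  have h7 := sq_nonneg (V - 2/9 * Psi)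
  have h8 := sq_nonneg (V - 2/3 * P)
  have h9 := mul_nonneg hZ hW
  have h10 := sq_nonneg Psi
  have hk : 0 ≤ k := (abs_nonneg _).trans hP1
  have h11 := mul_nonneg hk hW
  linarith

namespace Sys
variable {T : ℝ} {x v ρ : ℝ → ℝ → ℝ}

set_option maxHeartbeats 1000000 in
lemma step7a (S : Sys T x v ρ) {t0 k c0 v0 z1 δ : ℝ} (h0 : 0 < t0) (hT : t0 < T)
    (hk : 0 < k) (hv0 : 0 < v0) (hz1 : 0 < z1) (hδ : 0 < δ)
    (hB : ∀ ξ t, t0 ≤ t → t < T → |v ξ t| ≤ v0 ∧ Bd k c0 (v ξ t))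
    (hZ : ∀ ξ t, t0 ≤ t → t < T → ZZ ρ x ξ t ≤ z1)
    (hN : ∀ ξ t, t0 ≤ t → t < T → δ ≤ rexp (2 * x ξ t)) :
    ∃ c, ∀ ξ t, t0 ≤ t → t < T → ZZ ρ x ξ t - DD ρ x ξ t + WW ρ x v ξ t ≤ c := by
  have hY := ((S.b S.smZ).sub (S.b S.smD)).add (S.b S.smW)
  have hY1 := ((S.b (S.d S.smZ)).sub (S.b (S.d S.smD))).add (S.b (S.d S.smW))
  set ps := (k * v0)^2 with hps
  set C' := (8 * z1 + 4 * ps + 1)/δ with hC'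
  have hd := hY.addct (-C')
  have hper : Per (fun ξ t => ZZ ρ x ξ t - DD ρ x ξ t + WW ρ x v ξ t + -C' * t) := fun ξ t => by
    simp only [S.perZ ξ t, S.perD ξ t, S.perW ξ t]
  obtain ⟨C, hC, hCb⟩ := exists_bd hd.sm hper ⟨h0, hT⟩
  have hC'p : 0 < C' := by positivity
  set A := C + (3/4) * (12 * z1 + 5 * k) with hA
  have hmain := hd.max hY1 hper S.sρ S.hp h0 (A := A) (fun ξ => by
    have : 0 < (3/4) * (12 * z1 + 5 * k) := by positivity
    linarith [hCb ξ]) (by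
    intro ξ t ht htt e1 e2 e3
    have hE := Real.exp_pos (-2 * x ξ t)
    have b1 := hB ξ t htt.le ht.2
    have b3 := hZ ξ t htt.le ht.2
    have f1 := (S.evZ ht (ξ := ξ)).2
    have f2 := S.evD ht (ξ := ξ)
    have f3 := S.evW ht (ξ := ξ)
    have hPPs := PPsq ρ x v ξ t
    have hWn := Wnn ρ x v ξ t
    have hZn := Znn ρ x ξ t
    have hEδ : rexp (-2 * x ξ t) ≤ 1/δ := by
      rw [EN, one_div]; exact inv_anti₀ hδ (hN ξ t htt.le ht.2)
    have hPs : Ps (v ξ t) ^ 2 ≤ ps := by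
      rw [← sq_abs]
      refine (pow_le_pow_left₀ (abs_nonneg _) b1.2.ps 2).trans ?_
      exact pow_le_pow_left₀ (by positivity) (mul_le_mul_of_nonneg_left b1.1 hk.le) 2
    have htp : 0 ≤ C' * t := mul_nonneg hC'p.le ht.1.le
    have hYA : A ≤ ZZ ρ x ξ t - DD ρ x ξ t + WW ρ x v ξ t := by linarith
    have hAA : (3/4) * (12 * z1 + 5 * k) ≤ A := by linarith
    have hAp : 0 ≤ A := by positivity
    have hal := alg7 (V := VV ρ x v ξ t) hZn b3 hWn hPPs hPs b1.2.ps1 b1.2.ph (Ph_le _)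
      (hAp.trans hYA)
    rw [f1, f2, f3]
    have hWY := mul_le_mul_of_nonneg_left (hAA.trans hYA) hWn
    set E := rexp (-2 * x ξ t) with hEdef
    set X1 := Ds ρ x ξ t
    set Z := ZZ ρ x ξ t
    set D := DD ρ x ξ t
    set D1 := Ds ρ (DD ρ x) ξ t
    set Z1 := Ds ρ (ZZ ρ x) ξ t
    set W1 := Ds ρ (WW ρ x v) ξ t
    set W := WW ρ x v ξ t
    set RZ := (- 2 * D ^ 2 + 4 * Z * D + 2 * Ph (v ξ t) * Z - 4 * Z ^ 2 - 8/9 * Ps (v ξ t) * PP ρ x v ξ t - 4/3 * W * Z)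
    set RD := (- 2 * D ^ 2 - 4 * Z * D - 2 * (Ph (v ξ t) - 2 * Z) * Z + 8/9 * Ps (v ξ t) * PP ρ x v ξ t - 4/9 * Ps1 (v ξ t) * W
       - 4/9 * Ps (v ξ t) * VV ρ x v ξ t - 4/3 * PP ρ x v ξ t * VV ρ x v ξ t - 4/3 * W * D)
    set RW := (- 2 * VV ρ x v ξ t ^ 2 + W * (2 * Ps1 (v ξ t) - 2 * Ph (v ξ t) - 2 * Z) - 4 * Ps (v ξ t) * PP ρ x v ξ t - 4/3 * W ^ 2)
    have hR : RZ - RD + RW ≤ 8 * z1 + 4 * ps := by linarith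
    have hER : E * (RZ - RD + RW) ≤ (1/δ) * (8 * z1 + 4 * ps) := by
        have h1 : E * (RZ - RD + RW) ≤ E * (8 * z1 + 4 * ps) := mul_le_mul_of_nonneg_left hR hE.le
        have h2 : E * (8 * z1 + 4 * ps) ≤ (1/δ) * (8 * z1 + 4 * ps) :=
          mul_le_mul_of_nonneg_right hEδ (by positivity)
        exact h1.trans h2
    have hCC : (1/δ) * (8 * z1 + 4 * ps) < C' := by
      rw [hC', one_div, div_eq_inv_mul]
      exact mul_lt_mul_of_pos_left (by linarith) (by positivity)
    have hX : X1 * (Z1 - D1 + W1) = 0 := by rw [e2, mul_zero]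
    clear_value RZ RD RW E X1 Z D D1 Z1 W1 W
    linarith)
  refine ⟨A + C' * T, fun ξ t h1 h2 => ?_⟩
  have h3 := hmain ξ t h1 h2
  have : C' * t ≤ C' * T := mul_le_mul_of_nonneg_left h2.le hC'p.le
  linarith

lemma step7b (S : Sys T x v ρ) {t0 k c0 v0 z1 δ c lam A : ℝ} (h0 : 0 < t0) (hT : t0 < T)
    (hk : 0 < k) (hv0 : 0 < v0) (hz1 : 0 < z1) (hδ : 0 < δ) (hlam : 1 ≤ lam)
    (hB : ∀ ξ t, t0 ≤ t → t < T → |v ξ t| ≤ v0 ∧ Bd k c0 (v ξ t))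
    (hZ : ∀ ξ t, t0 ≤ t → t < T → ZZ ρ x ξ t ≤ z1)
    (hN : ∀ ξ t, t0 ≤ t → t < T → δ ≤ rexp (2 * x ξ t))
    (hY : ∀ ξ t, t0 ≤ t → t < T → ZZ ρ x ξ t - DD ρ x ξ t + WW ρ x v ξ t ≤ c)
    (hD : ∀ ξ t, t0 ≤ t → t < T → DD ρ x ξ t + lam * WW ρ x v ξ t ≤ A) :
    ∃ m, 1 ≤ m ∧ ∀ ξ t, t0 ≤ t → t < T → |Ds ρ x ξ t| ≤ m ∧ |Ds ρ (Ds ρ x) ξ t| ≤ m ∧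
      |Ds ρ v ξ t| ≤ m ∧ |Ps (v ξ t)| ≤ m ∧ |Ps1 (v ξ t)| ≤ m ∧ |Ps2 (v ξ t)| ≤ m ∧
      rexp (-2 * x ξ t) ≤ m := by
  set B := |c| + |A| + z1 + 1 with hBdef
  have hBp : 1 ≤ B := by have := abs_nonneg c; have := abs_nonneg A; linarith
  refine ⟨1 + k * v0 + k + 3 * (1/δ) * B, ?_, fun ξ t h1 h2 => ?_⟩
  · have : 0 < k * v0 := by positivity
    have : 0 < 3 * (1/δ) * B := by positivity
    linarith
  have hkv : 0 < k * v0 := by positivity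
  have hδB : 0 < (1/δ) * B := by positivity
  have hδδB : 1/δ ≤ (1/δ) * B := le_mul_of_one_le_right (by positivity) hBp
  have hE := Real.exp_pos (-2 * x ξ t)
  have hEδ : rexp (-2 * x ξ t) ≤ 1/δ := by
    rw [EN, one_div]; exact inv_anti₀ hδ (hN ξ t h1 h2)
  obtain ⟨b1, b2⟩ := hB ξ t h1 h2
  have hZn := Znn ρ x ξ t
  have hWn := Wnn ρ x v ξ t
  have hZz := hZ ξ t h1 h2
  have hy := hY ξ t h1 h2
  have hdd := hD ξ t h1 h2
  have hlw : WW ρ x v ξ t ≤ lam * WW ρ x v ξ t := le_mul_of_one_le_left hWn hlam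
  have hc := le_abs_self c
  have hA := le_abs_self A
  have hc' := abs_nonneg c
  have hA' := abs_nonneg A
  have hW : WW ρ x v ξ t ≤ B := by linarith
  have hDa : |DD ρ x ξ t| ≤ B := abs_le.2 ⟨by linarith, by linarith⟩
  have hZB : ZZ ρ x ξ t ≤ B := by linarith
  have ex1 : Ds ρ x ξ t ^ 2 = rexp (-2 * x ξ t) * ZZ ρ x ξ t := by
    simp only [ZZ]; rw [EN]; field_simp
  have ev1 : Ds ρ v ξ t ^ 2 = rexp (-2 * x ξ t) * WW ρ x v ξ t := by
    simp only [WW]; rw [EN]; field_simp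
  have ex2 : Ds ρ (Ds ρ x) ξ t = rexp (-2 * x ξ t) * DD ρ x ξ t - Ds ρ x ξ t ^ 2 := by
    simp only [DD]; rw [EN]; field_simp; ring
  have q1 : Ds ρ x ξ t ^ 2 ≤ (1/δ) * B := by
    rw [ex1]; exact mul_le_mul hEδ hZB hZn (by positivity)
  have q2 : Ds ρ v ξ t ^ 2 ≤ (1/δ) * B := by
    rw [ev1]; exact mul_le_mul hEδ hW hWn (by positivity)
  have q3 : |Ds ρ (Ds ρ x) ξ t| ≤ 2 * ((1/δ) * B) := by
    rw [ex2]
    refine (abs_sub _ _).trans ?_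
    rw [abs_mul, abs_of_pos hE, abs_of_nonneg (sq_nonneg (Ds ρ x ξ t))]
    have := mul_le_mul hEδ hDa (abs_nonneg _) (by positivity)
    linarith
  have ab : ∀ y : ℝ, y^2 ≤ (1/δ) * B → |y| ≤ 1 + (1/δ) * B := fun y hy => by
    rw [← sq_abs] at hy; nlinarith [abs_nonneg y, sq_nonneg (|y| - 1)]
  have q4 := ab _ q1
  have q5 := ab _ q2
  have q6 : |Ps (v ξ t)| ≤ k * v0 := b2.ps.trans (mul_le_mul_of_nonneg_left b1 hk.le)
  have q7 := b2.ps1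
  have q8 := b2.ps2
  refine ⟨by linarith, by linarith, by linarith, by linarith, by linarith, by linarith, by linarith⟩

lemma alg7c {m x1 x2 v1 v2 v3 v4 p p1 p2 E : ℝ} (hm : 1 ≤ m) (h1 : |x1| ≤ m) (h2 : |x2| ≤ m)
    (h3 : |v1| ≤ m) (hp : |p| ≤ m) (hp1 : |p1| ≤ m) (hp2 : |p2| ≤ m) (hE0 : 0 < E) (hE : E ≤ m)
    (h23 : v2 * v3 = 0) (h24 : v2 * v4 ≤ 0) :
    2 * v2 * (v4 + 3 * (x2 * v2 + x1 * v3) - 3 * (x1 ^ 2 * v2 + 2 * x1 * x2 * v1)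
      - 2 * (v1 ^ 2 * v2) + (p2 * v1 ^ 2 + p1 * v2 - 2 * (p1 * v1 * x1 + p * x2)
        - 2 * x1 * (p1 * v1 - 2 * (p * x1))) * E - (3 * (x2 + x1 ^ 2) + 2/3 * v1 ^ 2) * v2) ≤
      (2 * m^2 + 17 * m^4) * (v2^2 + 1) := by
  have hm0 : 0 ≤ m := by linarith
  have hEa : |E| ≤ m := by rwa [abs_of_pos hE0]
  have m2 : ∀ {a b : ℝ}, |a| ≤ m → |b| ≤ m → |a * b| ≤ m^2 := fun ha hb => by
    rw [abs_mul, sq]; exact mul_le_mul ha hb (abs_nonneg _) hm0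
  have m3 : ∀ {a b c : ℝ}, |a| ≤ m → |b| ≤ m → |c| ≤ m → |a * b * c| ≤ m^3 := fun ha hb hc => by
    rw [abs_mul, pow_succ]; exact mul_le_mul (m2 ha hb) hc (abs_nonneg _) (by positivity)
  have m4 : ∀ {a b c d : ℝ}, |a| ≤ m → |b| ≤ m → |c| ≤ m → |d| ≤ m → |a * b * c * d| ≤ m^4 :=
    fun ha hb hc hd => by
    rw [abs_mul, pow_succ]; exact mul_le_mul (m3 ha hb hc) hd (abs_nonneg _) (by positivity)
  have m34 : m^3 ≤ m^4 := pow_le_pow_right₀ hm (by norm_num)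
  have a1 := abs_le.1 ((m3 h1 h2 h3).trans m34)
  have a2 := abs_le.1 (m4 hp2 h3 h3 hEa)
  have a3 := abs_le.1 (m4 hp1 h3 h1 hEa)
  have a4 := abs_le.1 ((m3 hp h2 hEa).trans m34)
  have a5 := abs_le.1 (m4 hp h1 h1 hEa)
  have a6 := abs_le.1 (m2 hp1 hEa)
  set R := -6 * (x1 * x2 * v1) + p2 * v1 * v1 * E - 4 * (p1 * v1 * x1 * E) - 2 * (p * x2 * E)
    + 4 * (p * x1 * x1 * E) with hR
  have hRa : |R| ≤ 17 * m^4 := abs_le.2 ⟨by linarith [a1.1,a1.2], by linarith [a1.1,a1.2]⟩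
  have hvR : 2 * v2 * R ≤ 17 * m^4 * (v2^2 + 1) := by
    have e1 : 2 * v2 * R ≤ 2 * |v2| * |R| := by
      have := le_abs_self (2 * v2 * R)
      rwa [abs_mul, abs_mul, abs_two] at this
    have e2 : 2 * |v2| * |R| ≤ 2 * |v2| * (17 * m^4) := mul_le_mul_of_nonneg_left hRa (by positivity)
    have e3 : 2 * |v2| ≤ v2^2 + 1 := by rw [← sq_abs]; nlinarith [sq_nonneg (|v2| - 1)]
    have e4 := mul_le_mul_of_nonneg_right e3 (show 0 ≤ 17 * m^4 by positivity)
    linarith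
  have hq : v2^2 * (p1 * E) ≤ v2^2 * m^2 := mul_le_mul_of_nonneg_left a6.2 (sq_nonneg _)
  have n1 := mul_nonneg (sq_nonneg v2) (sq_nonneg x1)
  have n2 := mul_nonneg (sq_nonneg v2) (sq_nonneg v1)
  have n3 := sq_nonneg m
  have key : 2 * v2 * (v4 + 3 * (x2 * v2 + x1 * v3) - 3 * (x1 ^ 2 * v2 + 2 * x1 * x2 * v1)
      - 2 * (v1 ^ 2 * v2) + (p2 * v1 ^ 2 + p1 * v2 - 2 * (p1 * v1 * x1 + p * x2)
        - 2 * x1 * (p1 * v1 - 2 * (p * x1))) * E - (3 * (x2 + x1 ^ 2) + 2/3 * v1 ^ 2) * v2)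
      = 2 * (v2 * v4) + 6 * x1 * (v2 * v3) - 12 * (v2^2 * x1^2) - (16/3) * (v2^2 * v1^2)
        + 2 * (v2^2 * (p1 * E)) + 2 * v2 * R := by rw [hR]; ring
  rw [key, h23]
  linarith

set_option maxHeartbeats 1000000 in
lemma step7c (S : Sys T x v ρ) {t0 m : ℝ} (h0 : 0 < t0) (hT : t0 < T) (hm : 1 ≤ m)
    (hb : ∀ ξ t, t0 ≤ t → t < T → |Ds ρ x ξ t| ≤ m ∧ |Ds ρ (Ds ρ x) ξ t| ≤ m ∧
      |Ds ρ v ξ t| ≤ m ∧ |Ps (v ξ t)| ≤ m ∧ |Ps1 (v ξ t)| ≤ m ∧ |Ps2 (v ξ t)| ≤ m ∧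
      rexp (-2 * x ξ t) ≤ m) :
    ∃ C, ∀ ξ t, t0 ≤ t → t < T → |Ds ρ (Ds ρ v) ξ t| ≤ C := by
  obtain ⟨q, hq, hqe⟩ := S.v2
  set B := 1 + (2 * m^2 + 17 * m^4) with hBdef
  have hBp : 0 < B := by positivity
  have hV3 := S.b (S.d (S.d (S.d S.sv)))
  have he := ((S.x0.cmul 0).addct (-B)).exp
  have he1 := (S.x1.cmul 0).mul he
  have hd := (hq.sq.addc 1).mul he
  have hd1 := (((hq.cmul 2).mul hV3).mul he).add ((hq.sq.addc 1).mul he1)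
  have pv2 : Per (Ds ρ (Ds ρ v)) := S.p1 (S.p1 S.pv)
  have hper : Per (fun ξ t => (Ds ρ (Ds ρ v) ξ t ^ 2 + 1) * rexp (0 * x ξ t + -B * t)) := fun ξ t => by
    simp only [pv2 ξ t, S.px ξ t]
  obtain ⟨C, hC, hCb⟩ := exists_bd hd.sm hper ⟨h0, hT⟩
  have hmain := hd.max hd1 hper S.sρ S.hp h0 (A := C) hCb (by
    intro ξ t ht htt e1 e2 e3
    obtain ⟨b1, b2, b3, b4, b5, b6, b7⟩ := hb ξ t htt.le ht.2
    have hE := Real.exp_pos (-2 * x ξ t)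
    have hee := Real.exp_pos (0 * x ξ t + -B * t)
    simp only [hqe ξ t ht]
    set e := rexp (0 * x ξ t + -B * t)
    set x1 := Ds ρ x ξ t
    set x2 := Ds ρ (Ds ρ x) ξ t
    set v1 := Ds ρ v ξ t
    set v2 := Ds ρ (Ds ρ v) ξ t
    set v3 := Ds ρ (Ds ρ (Ds ρ v)) ξ t
    set v4 := Ds ρ (Ds ρ (Ds ρ (Ds ρ v))) ξ t
    have h23 : v2 * v3 = 0 := by
      have : (v2 * v3) * e = 0 := by linarith
      exact (mul_eq_zero.1 this).resolve_right hee.ne'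
    have h24 : v2 * v4 ≤ 0 := by
      have h5 : (v3^2 + v2 * v4) * e ≤ 0 := by
        nlinarith [mul_eq_zero_of_left h23 (x1 * e)]
      have h6 : v3^2 + v2 * v4 ≤ 0 := by
        by_contra h; push Not at h
        have := mul_pos h hee; linarith
      nlinarith [sq_nonneg v3]
    have := alg7c hm b1 b2 b3 b4 b5 b6 hE b7 h23 h24
    rw [show ∀ F G : ℝ, 2 * v2 * F * e + (v2^2+1) * ((0 * G + -B) * e) = (2 * v2 * F - B * (v2^2+1)) * e
      from fun F G => by ring]
    refine mul_neg_of_neg_of_pos ?_ hee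
    have h7 := sq_nonneg v2
    rw [hBdef]
    linarith)
  refine ⟨1 + C * rexp (B * T), fun ξ t h1 h2 => ?_⟩
  have h3 := hmain ξ t h1 h2
  have h4 : Ds ρ (Ds ρ v) ξ t ^ 2 + 1 ≤ C * rexp (B * T) := by
    have h5 : rexp (0 * x ξ t + -B * t) * rexp (B * t) = 1 := by
      rw [← Real.exp_add]; simp
    have h6 := mul_le_mul_of_nonneg_right h3.le (Real.exp_pos (B * t)).le
    rw [mul_assoc, h5, mul_one] at h6
    refine h6.trans (mul_le_mul_of_nonneg_left (Real.exp_le_exp.2 ?_) hC.le)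
    exact mul_le_mul_of_nonneg_left h2.le hBp.le
  rw [← sq_abs] at h4
  nlinarith [sq_nonneg (|Ds ρ (Ds ρ v) ξ t| - 1)]

end Sys

lemma fgexp {f g : ℝ → ℝ → ℝ} {ξ t : ℝ} (hf : 0 < f ξ t) (hg : 0 < g ξ t) :
    (f ξ t)^2 / (g ξ t)^4 = rexp (8 * vv f g ξ t / 3) * rexp (-2 * xx f g ξ t) ∧
    1 / (g ξ t)^2 = rexp (2 * vv f g ξ t / 3) * rexp (-2 * xx f g ξ t) := by
  obtain ⟨h1, h2⟩ := fexp hf hg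
  constructor
  · rw [div_eq_iff (by positivity)]
    rw [h1, h2]
    simp only [← Real.exp_nat_mul, ← Real.exp_add]
    congr 1; push_cast; ring
  · rw [div_eq_iff (by positivity)]
    conv_rhs => rw [h2]
    simp only [← Real.exp_nat_mul, ← Real.exp_add]
    rw [eq_comm, Real.exp_eq_one_iff]; push_cast; ring

lemma abst {a b c B : ℝ} (ha : |a| ≤ B) (hb : |b| ≤ B) (hc : |c| ≤ B) :
    |a + 2 * b| ≤ 3 * B ∧ |a + b + c| ≤ 3 * B := by
  rw [abs_le] at *
  rw [abs_le]
  refine ⟨⟨?_, ?_⟩, ?_, ?_⟩ <;> linarith [ha.1, ha.2, hb.1, hb.2, hc.1, hc.2]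

lemma alg7d {m x1 x2 v1 v2 F G : ℝ} (hm : 1 ≤ m) (h1 : |x1| ≤ m) (h2 : |x2| ≤ m)
    (h3 : |v1| ≤ m) (h4 : |v2| ≤ m) (hF : |F| ≤ m) (hG : |G| ≤ m) :
    |-(x2 + 2/3 * v2 + (x1 + 2/3 * v1)^2)| ≤ 10 * m^2 ∧ |-(x2 - 1/3 * v2 + (x1 - 1/3 * v1)^2)| ≤ 10 * m^2
    ∧ |F - (x1 + 2/3 * v1) * (x1 - 1/3 * v1)| ≤ 10 * m^2 ∧
    |4 * G - 3 * F - (x1 - 1/3 * v1)^2| ≤ 10 * m^2 := by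
  have mm : m ≤ m^2 := by nlinarith
  have m2 : ∀ {a b : ℝ}, |a| ≤ m → |b| ≤ m → |a * b| ≤ m^2 := fun ha hb => by
    rw [abs_mul, sq]; exact mul_le_mul ha hb (abs_nonneg _) (by linarith)
  have a1 := abs_le.1 (m2 h1 h1)
  have a2 := abs_le.1 (m2 h1 h3)
  have a3 := abs_le.1 (m2 h3 h3)
  rw [abs_le] at h1 h2 h3 h4 hF hG
  simp only [abs_le]
  refine ⟨⟨?_, ?_⟩, ⟨?_, ?_⟩, ⟨?_, ?_⟩, ?_, ?_⟩ <;>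
    linarith [a1.1, a1.2, a2.1, a2.2, a3.1, a3.2, h1.1, h1.2, h2.1, h2.2, h3.1, h3.2, h4.1, h4.2,
      hF.1, hF.2, hG.1, hG.2]

set_option maxHeartbeats 1000000 in
lemma step7d {T : ℝ} {f g ρ : ℝ → ℝ → ℝ} (sol : WarpedBerger T f g ρ) (hbl : RicciBlowup T f g ρ)
    {t0 v0 m C : ℝ} (h0 : 0 < t0) (hT : t0 < T) (hm : 1 ≤ m)
    (hv : ∀ ξ t, t0 ≤ t → t < T → |vv f g ξ t| ≤ v0)
    (hb : ∀ ξ t, t0 ≤ t → t < T → |Ds ρ (xx f g) ξ t| ≤ m ∧ |Ds ρ (Ds ρ (xx f g)) ξ t| ≤ m ∧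
      |Ds ρ (vv f g) ξ t| ≤ m ∧ rexp (-2 * xx f g ξ t) ≤ m)
    (hC : ∀ ξ t, t0 ≤ t → t < T → |Ds ρ (Ds ρ (vv f g)) ξ t| ≤ C) : False := by
  obtain ⟨S, hgeo⟩ := mkSys sol
  have hv0 : 0 ≤ v0 := (abs_nonneg _).trans (hv 0 t0 le_rfl hT)
  have hC0 : 0 ≤ C := (abs_nonneg _).trans (hC 0 t0 le_rfl hT)
  set L := C + rexp (8 * v0/3) * m with hL
  have hmL : m ≤ L := by
    have : 1 ≤ rexp (8 * v0/3) := Real.one_le_exp (by positivity)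
    nlinarith
  obtain ⟨ξ, t, h1, h2, h3⟩ := hbl (90 * L^2) t0 h0.le hT
  obtain ⟨b1, b2, b3, b4⟩ := hb ξ t h1.le h2
  have b5 := hC ξ t h1.le h2
  have b6 := abs_le.1 (hv ξ t h1.le h2)
  have hf := sol.f_pos ξ t (h0.trans h1).le h2
  have hg := sol.g_pos ξ t (h0.trans h1).le h2
  obtain ⟨g1, g2, g3, g4⟩ := hgeo ξ t ⟨h0.trans h1, h2⟩
  obtain ⟨e1, e2⟩ := fgexp hf hg
  have hF : |(f ξ t)^2 / (g ξ t)^4| ≤ L := by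
    rw [abs_of_nonneg (by positivity), e1]
    have := mul_le_mul (Real.exp_le_exp.2 (show 8 * vv f g ξ t / 3 ≤ 8 * v0/3 by linarith)) b4
      (Real.exp_pos _).le (Real.exp_pos _).le
    linarith
  have hG : |1 / (g ξ t)^2| ≤ L := by
    rw [abs_of_nonneg (by positivity), e2]
    have := mul_le_mul (Real.exp_le_exp.2 (show 2 * vv f g ξ t / 3 ≤ 8 * v0/3 by linarith)) b4
      (Real.exp_pos _).le (Real.exp_pos _).le
    linarith
  have hmv : C ≤ L := by
    have : 0 < rexp (8 * v0/3) * m := by positivity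
    linarith
  have hk := alg7d (hm.trans hmL) (b1.trans hmL) (b2.trans hmL) (b3.trans hmL) (b5.trans hmv) hF hG
  have k1 : k01 ρ f ξ t = -(Ds ρ (Ds ρ (xx f g)) ξ t + 2/3 * Ds ρ (Ds ρ (vv f g)) ξ t + (Ds ρ (xx f g) ξ t + 2/3 * Ds ρ (vv f g) ξ t)^2) := by
    unfold k01; rw [g3]; field_simp
  have k2 : k02 ρ g ξ t = -(Ds ρ (Ds ρ (xx f g)) ξ t - 1/3 * Ds ρ (Ds ρ (vv f g)) ξ t + (Ds ρ (xx f g) ξ t - 1/3 * Ds ρ (vv f g) ξ t)^2) := by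
    unfold k02; rw [g4]; field_simp
  have k3 : k12 ρ f g ξ t = (f ξ t)^2 / (g ξ t)^4 - (Ds ρ (xx f g) ξ t + 2/3 * Ds ρ (vv f g) ξ t) * (Ds ρ (xx f g) ξ t - 1/3 * Ds ρ (vv f g) ξ t) := by
    unfold k12; rw [g1, g2]; field_simp
  have k4 : k23 ρ f g ξ t = 4 * (1 / (g ξ t)^2) - 3 * ((f ξ t)^2 / (g ξ t)^4) - (Ds ρ (xx f g) ξ t - 1/3 * Ds ρ (vv f g) ξ t)^2 := by
    unfold k23; rw [g2]; field_simp
  rw [← k1, ← k2, ← k3, ← k4] at hk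
  obtain ⟨r1, r2, r3, r4⟩ := hk
  have s1 := (abst r1 r3 r3).1
  have s2 := (abst r1 r2 r2).1
  have s3 := (abst r2 r3 r4).2
  have hL2 : 0 < L^2 := by have : 0 < L := by linarith
                           positivity
  linarith
end

section
set_option linter.unusedVariables false

namespace Sys
variable {T : ℝ} {x v ρ : ℝ → ℝ → ℝ}

lemma pack (S : Sys T x v ρ) {t0 : ℝ} (h0 : 0 < t0) (hT : t0 < T) :
    ∃ k c0 v0 z1 α c1 lam K A, 0 < k ∧ 0 < v0 ∧ 0 < z1 ∧ 0 < α ∧ 0 < c1 ∧ 1 ≤ lam ∧ 0 < A ∧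
      (∀ ξ t, t0 ≤ t → t < T → |v ξ t| ≤ v0 ∧ Bd k c0 (v ξ t)) ∧
      (∀ ξ t, t0 ≤ t → t < T → ZZ ρ x ξ t ≤ z1) ∧
      (∀ ξ t, t0 ≤ t → t < T → |v ξ t| ≤ c1 * rexp (α * x ξ t)) ∧
      (∀ ξ t, t0 ≤ t → t < T → 4 ≤ K - 2 * x ξ t ∧
        DD ρ x ξ t + lam * WW ρ x v ξ t ≤ A / (K - 2 * x ξ t)) := by
  obtain ⟨k, c0, v0, hk, hc0, hv0, hB⟩ := S.step1 h0 hT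
  have hB' := fun ξ t h1 h2 => (hB ξ t h1 h2).2
  obtain ⟨X0, hX⟩ := S.step2 h0 hT hB'
  obtain ⟨z1, hz1, hZ⟩ := S.step3 h0 hT hk hv0 hB
  obtain ⟨α, c1, hα, hα1, hc1, hV⟩ := S.step4 h0 hT hc0 hz1 hB' hZ
  obtain ⟨c5, hc5, hZ5⟩ := S.step5 h0 hT hk hα hα1 hc1 hB' hX hV
  obtain ⟨lam, K, A, hlam, hA, hD⟩ := S.step6 h0 hT hk hα hα1 hc1 hz1 hc5 hB' hX hZ hV hZ5
  exact ⟨k, c0, v0, z1, α, c1, lam, K, A, hk, hv0, hz1, hα, hc1, hlam, hA, hB, hZ, hV, hD⟩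

lemma step8 (S : Sys T x v ρ) {t0 c η : ℝ} (h0 : 0 < t0) (hT : t0 < T) (hη : 0 < η)
    (hN : ∀ ξ, c ≤ rexp (2 * x ξ t0)) : ∀ ξ t, t0 ≤ t → t < T →
      c - (4 + η) * (t - t0) - η ≤ rexp (2 * x ξ t) := by
  have hd := ((S.b S.smN).cmul (-1)).addct (-(4 + η))
  have hd1 := (S.b (S.d S.smN)).cmul (-1)
  have hper : Per (fun ξ t => -1 * rexp (2 * x ξ t) + -(4 + η) * t) := fun ξ t => by
    simp only [S.px ξ t]
  have hmain := hd.max hd1 hper S.sρ S.hp h0 (A := -c - (4+η) * t0 + η)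
    (fun ξ => by linarith [hN ξ]) (by
    intro ξ t ht htt e1 e2 e3
    obtain ⟨f1, f2, f3⟩ := S.evN ht (ξ := ξ)
    have hP2 := Ph_le (v ξ t)
    have hZn := Znn ρ x ξ t
    rw [f2]
    have e2' : Ds ρ (fun ξ t => rexp (2 * x ξ t)) ξ t = 0 := by linarith
    rw [e2']
    linarith)
  intro ξ t h1 h2
  have := hmain ξ t h1 h2
  linarith

lemma step9 (S : Sys T x v ρ) {t0 k c0 α c1 lam K A δ : ℝ} (h0 : 0 < t0) (hT : t0 < T)
    (hk : 0 < k) (hα : 0 < α) (hc1 : 0 < c1) (hlam : 1 ≤ lam) (hA : 0 < A) (hδ : 0 < δ) (hδ4 : δ < 4)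
    (hB : ∀ ξ t, t0 ≤ t → t < T → Bd k c0 (v ξ t))
    (hV : ∀ ξ t, t0 ≤ t → t < T → |v ξ t| ≤ c1 * rexp (α * x ξ t))
    (hD : ∀ ξ t, t0 ≤ t → t < T → 4 ≤ K - 2 * x ξ t ∧
        DD ρ x ξ t + lam * WW ρ x v ξ t ≤ A / (K - 2 * x ξ t)) :
    ∃ t1, t0 ≤ t1 ∧ t1 < T ∧ ∀ ξ s, t1 ≤ s → s < T → (4 - δ) * (T - s) ≤ rexp (2 * x ξ s) := by
  set L := Real.log (δ / (8 * k * c1^2)) with hL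
  set xs := min ((K - 8 * A / δ)/2) (L / (2 * α)) with hxs
  have small : ∀ ξ t, t0 ≤ t → t < T → x ξ t ≤ xs → 2 * DD ρ x ξ t - 2 * Ph (v ξ t) ≤ -4 + δ/2 := by
    intro ξ t h1 h2 h3
    obtain ⟨d1, d2⟩ := hD ξ t h1 h2
    have hW := Wnn ρ x v ξ t
    have hlw : 0 ≤ lam * WW ρ x v ξ t := by positivity
    have g1 : x ξ t ≤ (K - 8 * A / δ)/2 := h3.trans (min_le_left _ _)
    have g2 : x ξ t ≤ L / (2 * α) := h3.trans (min_le_right _ _)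
    have g3 : A / (K - 2 * x ξ t) ≤ δ / 8 := by
      rw [div_le_iff₀ (by linarith)]
      have : 8 * A / δ ≤ K - 2 * x ξ t := by linarith
      rw [div_le_iff₀ hδ] at this
      linarith
    have g4 : rexp (α * x ξ t)^2 ≤ δ / (8 * k * c1^2) := by
      rw [le_div_iff₀ (by positivity)] at g2
      rw [← Real.exp_nat_mul, ← Real.le_log_iff_exp_le (by positivity)]
      push_cast; linarith
    have g5 : v ξ t ^ 2 ≤ c1^2 * rexp (α * x ξ t)^2 := by
      rw [← sq_abs, ← mul_pow]
      exact pow_le_pow_left₀ (abs_nonneg _) (hV ξ t h1 h2) 2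
    have g6 : k * v ξ t ^ 2 ≤ δ / 8 := by
      have a1 : k * v ξ t ^ 2 ≤ k * (c1^2 * (δ / (8 * k * c1^2))) :=
        mul_le_mul_of_nonneg_left (g5.trans (mul_le_mul_of_nonneg_left g4 (by positivity))) hk.le
      have a2 : k * (c1^2 * (δ / (8 * k * c1^2))) = δ / 8 := by field_simp
      linarith
    have g7 := (hB ξ t h1 h2).phl
    linarith
  have hη := Real.exp_pos (2 * xs)
  refine ⟨max t0 (T - rexp (2 * xs) / 4), le_max_left _ _, max_lt hT (by linarith), ?_⟩
  intro ξ s hs1 hs2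
  have hs0 : t0 ≤ s := (le_max_left _ _).trans hs1
  have hs3 : T - rexp (2 * xs) / 4 ≤ s := (le_max_right _ _).trans hs1
  by_contra hcon
  push Not at hcon
  set c := rexp (2 * x ξ s) + (4 - δ) * s with hc
  have hcT : c < (4 - δ) * T := by linarith
  have hd := (S.b S.smN).addct (4 - δ)
  have hper : Per (fun ξ t => rexp (2 * x ξ t) + (4 - δ) * t) := fun ξ t => by
    simp only [S.px ξ t]
  have hs00 : 0 < s := h0.trans_le hs0
  have hmain := minP hd.sm hper hs00 (c := c) ⟨ξ, le_rfl⟩ (by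
    intro ξ t h1 h2 h3 h4
    have ht : 0 < t ∧ t < T := ⟨hs00.trans_le h1, h2⟩
    rw [hd.dt ht]
    obtain ⟨f1, f2, f3⟩ := S.evN ht (ξ := ξ)
    have hlm : IsLocalMin (fun y => (fun ξ t => rexp (2 * x ξ t)) y t) ξ :=
      Eventually.of_forall (fun y => by have := h4 y; simp only at this ⊢; linarith)
    have hp1 : pd1 (fun ξ t => rexp (2 * x ξ t)) ξ t = 0 := hlm.deriv_eq_zero
    have hx1 : Ds ρ x ξ t = 0 := by
      have : Ds ρ (fun ξ t => rexp (2 * x ξ t)) ξ t = 0 := by simp only [Ds, hp1, zero_div]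
      rw [this] at f1
      have hp := Real.exp_pos (2 * x ξ t)
      rcases mul_eq_zero.1 f1.symm with h | h
      · linarith
      · exact absurd h hp.ne'
    have hZ0 : ZZ ρ x ξ t = 0 := by simp [ZZ, hx1]
    rw [f3, hZ0]
    have hNη : rexp (2 * x ξ t) ≤ rexp (2 * xs) := by
      have a1 : (4 - δ) * (T - t) ≤ 4 * (T - t) := mul_le_mul_of_nonneg_right (by linarith) (by linarith)
      linarith
    have := small ξ t (hs0.trans h1) h2 (by have := Real.exp_le_exp.1 hNη; linarith)
    linarith)
  have h4δ : 0 < 4 - δ := by linarith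
  obtain ⟨y, hy⟩ := hmain (max s (c / (4 - δ))) (le_max_left _ _)
    (max_lt hs2 (by rw [div_lt_iff₀ h4δ]; linarith))
  have hy2 : c / (4 - δ) ≤ max s (c / (4 - δ)) := le_max_right _ _
  rw [div_le_iff₀ h4δ] at hy2
  have := Real.exp_pos (2 * x y (max s (c / (4 - δ))))
  linarith
end Sys

lemma step7 {T : ℝ} {f g ρ : ℝ → ℝ → ℝ} (sol : WarpedBerger T f g ρ) (hbl : RicciBlowup T f g ρ)
    {t0 δ : ℝ} (h0 : 0 < t0) (hT : t0 < T) (hδ : 0 < δ)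
    (hN : ∀ ξ t, t0 ≤ t → t < T → δ ≤ rexp (2 * xx f g ξ t)) : False := by
  obtain ⟨S, -⟩ := mkSys sol
  obtain ⟨k, c0, v0, z1, α, c1, lam, K, A, hk, hv0, hz1, hα, hc1, hlam, hA, hB, hZ, hV, hD⟩ := S.pack h0 hT
  obtain ⟨c, hY⟩ := S.step7a h0 hT hk hv0 hz1 hδ hB hZ hN
  have hD' : ∀ ξ t, t0 ≤ t → t < T → DD ρ (xx f g) ξ t + lam * WW ρ (xx f g) (vv f g) ξ t ≤ A :=
    fun ξ t h1 h2 => by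
      obtain ⟨d1, d2⟩ := hD ξ t h1 h2
      exact d2.trans (div_le_self hA.le (by linarith))
  obtain ⟨m, hm, hb⟩ := S.step7b h0 hT hk hv0 hz1 hδ hlam hB hZ hN hY hD'
  obtain ⟨C, hC⟩ := S.step7c h0 hT hm hb
  exact step7d sol hbl h0 hT hm (fun ξ t h1 h2 => (hB ξ t h1 h2).1)
    (fun ξ t h1 h2 => by
      obtain ⟨b1, b2, b3, b4, b5, b6, b7⟩ := hb ξ t h1 h2
      exact ⟨b1, b2, b3, b7⟩) hC

lemma upper {T : ℝ} {f g ρ : ℝ → ℝ → ℝ} (sol : WarpedBerger T f g ρ) (hbl : RicciBlowup T f g ρ)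
    {t0 : ℝ} (h0 : 0 < t0) (hT : t0 < T) : ∃ ξ, rexp (2 * xx f g ξ t0) ≤ 4 * (T - t0) := by
  obtain ⟨S, -⟩ := mkSys sol
  by_contra hcon
  push Not at hcon
  obtain ⟨ξ0, hξ0⟩ := exists_min S.smN S.perN ⟨h0, hT⟩
  set c := rexp (2 * xx f g ξ0 t0) with hc
  have hgap : 0 < c - 4 * (T - t0) := by have := hcon ξ0; linarith
  set gap := c - 4 * (T - t0) with hg
  have hTT : 0 < T - t0 + 1 := by linarith
  have hη : 0 < gap / (2 * (T - t0 + 1)) := by positivity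
  have h8 := S.step8 h0 hT hη hξ0
  refine step7 sol hbl h0 hT (half_pos hgap) (fun ξ t h1 h2 => ?_)
  have h9 := h8 ξ t h1 h2
  set η := gap / (2 * (T - t0 + 1)) with hηd
  have e1 : η * (T - t0 + 1) = gap / 2 := by rw [hηd]; field_simp
  have e2 : (4 + η) * (t - t0) ≤ (4 + η) * (T - t0) := mul_le_mul_of_nonneg_left (by linarith) (by linarith)
  linarith

lemma Mbd {f g : ℝ → ℝ → ℝ} {ξ t : ℝ} (hf : 0 < f ξ t) (hg : 0 < g ξ t) :
    M f g ξ t ≤ rexp (xx f g ξ t) ∧ ∀ w, |vv f g ξ t| ≤ w →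
      rexp (xx f g ξ t) * rexp (-(2 * w / 3)) ≤ M f g ξ t := by
  obtain ⟨h1, h2⟩ := fexp hf hg
  have hx := Real.exp_pos (xx f g ξ t)
  constructor
  · unfold M
    rcases le_total (vv f g ξ t) 0 with h | h
    · refine (min_le_left _ _).trans ?_
      rw [h1]
      exact mul_le_of_le_one_right hx.le (Real.exp_le_one_iff.2 (by linarith))
    · refine (min_le_right _ _).trans ?_
      rw [h2]
      exact mul_le_of_le_one_right hx.le (Real.exp_le_one_iff.2 (by linarith))
  · intro w hw
    have hw' := abs_le.1 hw
    have hw0 : 0 ≤ w := (abs_nonneg _).trans hw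
    refine le_min ?_ ?_
    · rw [h1]
      exact mul_le_mul_of_nonneg_left (Real.exp_le_exp.2 (by linarith)) hx.le
    · rw [h2]
      exact mul_le_mul_of_nonneg_left (Real.exp_le_exp.2 (by linarith)) hx.le

lemma Mup {T : ℝ} {f g ρ : ℝ → ℝ → ℝ} (sol : WarpedBerger T f g ρ) (hbl : RicciBlowup T f g ρ)
    {t : ℝ} (h0 : 0 < t) (hT : t < T) : Mcheck f g t ≤ 2 * √(T - t) := by
  obtain ⟨ξ, hξ⟩ := upper sol hbl h0 hT
  have h1 : Mcheck f g t ≤ M f g ξ t := by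
    refine ciInf_le ⟨0, ?_⟩ ξ
    rintro _ ⟨y, rfl⟩
    exact le_min (sol.f_pos y t h0.le hT).le (sol.g_pos y t h0.le hT).le
  have h2 := (Mbd (sol.f_pos ξ t h0.le hT) (sol.g_pos ξ t h0.le hT)).1
  refine h1.trans (h2.trans ?_)
  apply le_of_sq_le_sq _ (by positivity)
  rw [mul_pow, Real.sq_sqrt (by linarith), ← Real.exp_nat_mul]
  push_cast; linarith

lemma Mlow {T : ℝ} {f g ρ : ℝ → ℝ → ℝ} (sol : WarpedBerger T f g ρ) {a : ℝ} (ha1 : 1 ≤ a) (ha2 : a < 2) :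
    ∃ t1, 0 < t1 ∧ t1 < T ∧ ∀ t, t1 < t → t < T → a * √(T - t) < Mcheck f g t := by
  obtain ⟨S, -⟩ := mkSys sol
  have hTp := sol.T_pos
  have h0 : 0 < T/2 := by linarith
  have hT : T/2 < T := by linarith
  obtain ⟨k, c0, v0, z1, α, c1, lam, K, A, hk, hv0, hz1, hα, hc1, hlam, hA, hB, hZ, hV, hD⟩ := S.pack h0 hT
  set b := (a + 2)/2 with hb
  have hab : a < b := by linarith
  have hb2 : b < 2 := by linarith
  set e := (a + b)/2 with he
  have hae : a < e := by linarith
  have heb : e < b := by linarith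
  obtain ⟨t1, h1, h2, h3⟩ := S.step9 h0 hT hk hα hc1 hlam hA (δ := 4 - b^2) (by nlinarith) (by nlinarith)
    (fun ξ t h1 h2 => (hB ξ t h1 h2).2) hV hD
  set w := -(3/2) * Real.log (e / b) with hw
  have hwp : 0 < w := by
    have : Real.log (e / b) < 0 := Real.log_neg (by positivity) (by rw [div_lt_one (by linarith)]; exact heb)
    linarith
  have hwe : rexp (-(2 * w / 3)) = e / b := by
    rw [show -(2 * w / 3) = Real.log (e / b) by rw [hw]; ring, Real.exp_log (by positivity)]
  set xs := Real.log (w / c1) / α with hxs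
  set κ := rexp xs * rexp (-(2 * v0 / 3)) with hκ
  have hκp : 0 < κ := by positivity
  refine ⟨max t1 (T - κ^2/4), lt_max_of_lt_left (by linarith), max_lt h2 (by have : 0 < κ^2 := by positivity
                                                                             linarith), ?_⟩
  intro t ht1 ht2
  have g1 : t1 < t := (le_max_left _ _).trans_lt ht1
  have g2 : T - κ^2/4 < t := (le_max_right _ _).trans_lt ht1
  have g0 : T/2 ≤ t := by linarith
  have hsq : 0 < √(T - t) := Real.sqrt_pos.2 (by linarith)
  have hss : √(T - t)^2 = T - t := Real.sq_sqrt (by linarith)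
  have key : e * √(T - t) ≤ Mcheck f g t := by
    refine le_ciInf (fun ξ => ?_)
    have hM := (Mbd (sol.f_pos ξ t (by linarith) ht2) (sol.g_pos ξ t (by linarith) ht2)).2
    rcases le_total (xx f g ξ t) xs with hx | hx
    · have hvw : |vv f g ξ t| ≤ w := by
        refine (hV ξ t g0 ht2).trans ?_
        rw [hxs, le_div_iff₀ hα] at hx
        have : rexp (α * xx f g ξ t) ≤ w / c1 := by
          rw [← Real.le_log_iff_exp_le (by positivity)]; linarith
        rw [le_div_iff₀ hc1] at this
        linarith
      refine le_trans ?_ (hM w hvw)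
      rw [hwe]
      have hbx : b * √(T - t) ≤ rexp (xx f g ξ t) := by
        apply le_of_sq_le_sq _ (Real.exp_pos _).le
        rw [mul_pow, hss, ← Real.exp_nat_mul]
        have := h3 ξ t g1.le ht2
        push_cast; linarith
      have := mul_le_mul_of_nonneg_right hbx (show 0 ≤ e / b by positivity)
      have e2 : b * √(T - t) * (e / b) = e * √(T - t) := by
        have hb0 : b ≠ 0 := by linarith
        field_simp
      linarith
    · refine le_trans ?_ (hM v0 (hB ξ t g0 ht2).1)
      have h5 : κ ≤ rexp (xx f g ξ t) * rexp (-(2 * v0 / 3)) :=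
        mul_le_mul_of_nonneg_right (Real.exp_le_exp.2 hx) (Real.exp_pos _).le
      have h6 : 2 * √(T - t) ≤ κ := by
        apply le_of_sq_le_sq _ hκp.le
        rw [mul_pow, hss]; linarith
      have h7 : e * √(T - t) ≤ 2 * √(T - t) := mul_le_mul_of_nonneg_right (by linarith) hsq.le
      linarith
  exact (mul_lt_mul_of_pos_right hae hsq).trans_le key

lemma final {T : ℝ} {f g ρ : ℝ → ℝ → ℝ} (sol : WarpedBerger T f g ρ) (hbl : RicciBlowup T f g ρ) :
    Filter.Tendsto (fun t => Mcheck f g t / Real.sqrt (T - t)) (𝓝[<] T) (𝓝 2) := by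
  have hTp := sol.T_pos
  rw [tendsto_order]
  constructor
  · intro a ha
    obtain ⟨t1, h1, h2, h3⟩ := Mlow sol (a := max a 1) (le_max_right _ _) (max_lt ha (by norm_num))
    filter_upwards [Ioo_mem_nhdsLT h2] with t ht
    have hsq : 0 < √(T - t) := Real.sqrt_pos.2 (by linarith [ht.2])
    rw [lt_div_iff₀ hsq]
    exact (mul_le_mul_of_nonneg_right (le_max_left _ _) hsq.le).trans_lt (h3 t ht.1 ht.2)
  · intro a ha
    filter_upwards [Ioo_mem_nhdsLT hTp] with t ht
    have hsq : 0 < √(T - t) := Real.sqrt_pos.2 (by linarith [ht.2])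
    rw [div_lt_iff₀ hsq]
    exact (Mup sol hbl ht.1 ht.2).trans_lt (mul_lt_mul_of_pos_right ha hsq)
end

/-- Under Assumption B, the radius of a smallest neck is
`(1 + o(1))·2√(T−t)` as `t ↗ T`; that is, `M̌(t)/√(T−t) → 2`. -/
theorem neck_radius_asymptotics (T : ℝ) (f g ρ : ℝ → ℝ → ℝ)
    (sol : AssumptionB T f g ρ) :
    Filter.Tendsto (fun t => Mcheck f g t / Real.sqrt (T - t)) (𝓝[<] T) (𝓝 2) := by
  exact final sol.toAssumptionA.toWarpedBerger sol.ricci_blowup
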